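/- arXiv:math/0611416 — 5 statements merged into one kernel-verified Lean document; each statement's English description precedes it below -/
import Mathlib

section
/- Let (G_n) be a sequence of finite connected graphs with |G_n| → ∞, and for each n let v_n be a vertex of G_n such that Hom_{v_n}(G_n, ℤ) is nonempty. Let d = d(n) be the maximal degree of G_n. Then, for f_n chosen uniformly at random from Hom_{v_n}(G_n, ℤ), the probability Pr[R(f_n) ≤ (log₂ log₂ |G_n| − 1)/log₂(d(n)+1)] tends to 0 as n → ∞. -/
open Filter

/-- The set of graph homomorphisms from `G` to `ℤ` sending `v0` to `0`:
maps changing by exactly `1` along every edge. -/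
def ZHomSet {V : Type} (G : SimpleGraph V) (v0 : V) : Set (V → ℤ) :=
  {f | (∀ a b, G.Adj a b → |f a - f b| = 1) ∧ f v0 = 0}

/-- The maximal degree of a vertex of `G`. -/
noncomputable def maxDeg {V : Type} [Fintype V] (G : SimpleGraph V) : ℕ :=
  Finset.univ.sup fun x : V => {u | G.Adj x u}.ncard

namespace ZHom

variable {V : Type} {G : SimpleGraph V} {f : V → ℤ}

/-- Along a walk, the value of a homomorphism moves by at most the length, and with its parity. -/
lemma walk_bound (hf : ∀ a b, G.Adj a b → |f a - f b| = 1) {u w : V} (p : G.Walk u w) :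
    |f u - f w| ≤ p.length ∧ (2 : ℤ) ∣ f u - f w - p.length := by
  induction p with
  | nil => simp
  | cons h p ih =>
    have h1 := hf _ _ h
    rw [SimpleGraph.Walk.length_cons]
    push_cast
    rw [abs_le] at ih ⊢
    rcases (abs_eq (by norm_num)).1 h1 with h2 | h2 <;> omega

lemma dist_bound (hG : G.Connected) (hf : ∀ a b, G.Adj a b → |f a - f b| = 1) (u w : V) :
    |f u - f w| ≤ G.dist u w ∧ (2 : ℤ) ∣ f u - f w - G.dist u w := by
  obtain ⟨p, hp⟩ := hG.exists_walk_length_eq_dist u w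
  rw [← hp]
  exact walk_bound hf p

/-- A homomorphism takes every value between two of its values. -/
lemma mem_range_of_walk (hf : ∀ a b, G.Adj a b → |f a - f b| = 1) {u w : V} (p : G.Walk u w)
    {m : ℤ} (h₁ : f u ≤ m) (h₂ : m ≤ f w) : m ∈ Set.range f := by
  induction p with
  | nil => exact ⟨_, le_antisymm h₁ h₂⟩
  | @cons a b c h p ih =>
    rcases h₁.eq_or_lt with h3 | h3
    · exact ⟨a, h3⟩
    · have h4 := (abs_le.1 (hf _ _ h).le).1
      exact ih (by omega) h₂

lemma lt_ncard_range [Finite V] (hG : G.Connected) (hf : ∀ a b, G.Adj a b → |f a - f b| = 1)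
    {x w : V} {k : ℕ} (h : (k : ℤ) ≤ f x - f w) : k < (Set.range f).ncard := by
  obtain ⟨p⟩ := hG.preconnected w x
  have hsub : ((Finset.Icc (f w) (f x) : Finset ℤ) : Set ℤ) ⊆ Set.range f := fun m hm => by
    rw [Finset.mem_coe, Finset.mem_Icc] at hm
    exact mem_range_of_walk hf p hm.1 hm.2
  have h1 := Set.ncard_le_ncard hsub (Set.finite_range f)
  rw [Set.ncard_coe_finset, Int.card_Icc] at h1
  omega

/-- Geodesics visit every intermediate distance. -/
lemma exists_dist_eq (hG : G.Connected) {x u : V} {k : ℕ} (h : k ≤ G.dist x u) :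
    ∃ s, G.dist x s = k ∧ G.dist s u + k = G.dist x u := by
  obtain ⟨p, hp⟩ := hG.exists_walk_length_eq_dist x u
  refine ⟨p.getVert k, ?_⟩
  have h1 := SimpleGraph.dist_le (p.take k)
  have h2 := SimpleGraph.dist_le (p.drop k)
  rw [SimpleGraph.Walk.take_length] at h1
  rw [SimpleGraph.Walk.drop_length] at h2
  have h3 := hG.dist_triangle (u := x) (v := p.getVert k) (w := u)
  omega

lemma card_closedBall_le [Fintype V] (hG : G.Connected) (x : V) (r : ℕ) :
    {u | G.dist x u ≤ r}.ncard ≤ (maxDeg G + 1) ^ r := by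
  classical
  induction r with
  | zero =>
    have : {u | G.dist x u ≤ 0} = {x} := by
      ext u
      rw [Set.mem_ofPred_eq, Nat.le_zero, hG.dist_eq_zero_iff, Set.mem_singleton_iff, eq_comm]
    rw [this, Set.ncard_singleton, pow_zero]
  | succ r ih =>
    have hsub : {u | G.dist x u ≤ r + 1} ⊆
        ⋃ s ∈ (Set.toFinite {u | G.dist x u ≤ r}).toFinset, insert s {u | G.Adj s u} := by
      intro u hu
      simp only [Set.Finite.mem_toFinset, Set.mem_ofPred_eq, Set.mem_iUnion, exists_prop] at hu ⊢
      by_cases h : G.dist x u ≤ r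
      · exact ⟨u, h, Set.mem_insert _ _⟩
      · obtain ⟨s, hs, hsu⟩ := exists_dist_eq hG (x := x) (u := u) (k := r) (by omega)
        refine ⟨s, hs.le, Set.mem_insert_of_mem _ ?_⟩
        exact SimpleGraph.dist_eq_one_iff_adj.1 (by omega)
    refine (Set.ncard_le_ncard hsub (Set.toFinite _)).trans ?_
    refine (Finset.set_ncard_biUnion_le _ _).trans ?_
    refine (Finset.sum_le_card_nsmul _ _ (maxDeg G + 1) fun s _ => ?_).trans ?_
    · refine (Set.ncard_insert_le _ _).trans (Nat.add_le_add_right ?_ 1)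
      exact Finset.le_sup (f := fun x : V => {u | G.Adj x u}.ncard) (Finset.mem_univ s)
    · rw [← Set.ncard_eq_toFinset_card, smul_eq_mul, pow_succ]
      exact Nat.mul_le_mul_right _ ih

/-- There is a set of well separated vertices containing a given vertex, of large cardinality. -/
lemma exists_separated [Fintype V] (hG : G.Connected) (v : V) (r : ℕ) :
    ∃ S : Finset V, v ∈ S ∧ (∀ x ∈ S, ∀ y ∈ S, x ≠ y → r < G.dist x y) ∧
      Fintype.card V ≤ S.card * (maxDeg G + 1) ^ r := by
  classical
  let F : Finset (Finset V) := Finset.univ.filter fun S =>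
    v ∈ S ∧ ∀ x ∈ S, ∀ y ∈ S, x ≠ y → r < G.dist x y
  have hF : F.Nonempty := ⟨{v}, by
    simp only [F, Finset.mem_filter, Finset.mem_univ, Finset.mem_singleton, true_and]
    rintro x rfl y rfl h
    exact absurd rfl h⟩
  obtain ⟨S, hS, hmax⟩ := F.exists_max_image Finset.card hF
  obtain ⟨hvS, hsep⟩ := (Finset.mem_filter.1 hS).2
  refine ⟨S, hvS, hsep, ?_⟩
  have hcov : (Set.univ : Set V) ⊆ ⋃ s ∈ S, {u | G.dist s u ≤ r} := by
    intro u _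
    by_contra hu
    simp only [Set.mem_iUnion, Set.mem_ofPred_eq, exists_prop, not_exists, not_and, not_le] at hu
    have huS : u ∉ S := fun h => by simpa using hu u h
    have hmem : insert u S ∈ F := by
      refine Finset.mem_filter.2 ⟨Finset.mem_univ _, Finset.mem_insert_of_mem hvS, ?_⟩
      intro x hx y hy hxy
      rcases Finset.mem_insert.1 hx with hx | hx <;> rcases Finset.mem_insert.1 hy with hy | hy
      · exact absurd (hx.trans hy.symm) hxy
      · rw [hx, SimpleGraph.dist_comm]
        exact hu y hy
      · rw [hy]
        exact hu x hx
      · exact hsep x hx y hy hxy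
    have := hmax _ hmem
    rw [Finset.card_insert_of_notMem huS] at this
    omega
  have h1 := Set.ncard_le_ncard hcov (Set.toFinite _)
  rw [Set.ncard_univ, Nat.card_eq_fintype_card] at h1
  refine (h1.trans (Finset.set_ncard_biUnion_le _ _)).trans ?_
  exact Finset.sum_le_card_nsmul _ _ _ fun s _ => card_closedBall_le hG s r

/-- A function prescribed off a proper subset `S` has at most `2 ^ |S|` extensions to a
homomorphism. -/
lemma encard_extensions_le (hG : G.Connected) (v : V) (S : Finset V) (hv : v ∉ S) (g : V → ℤ) :
    {f : V → ℤ | (∀ a b, G.Adj a b → |f a - f b| = 1) ∧ ∀ u ∉ S, f u = g u}.encard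
      ≤ 2 ^ S.card := by
  classical
  induction hn : S.card generalizing S g with
  | zero =>
    rw [Finset.card_eq_zero] at hn
    subst hn
    refine (Set.encard_le_encard (t := {g}) ?_).trans (by simp)
    rintro f ⟨-, hf⟩
    exact funext fun u => hf u (by simp)
  | succ n ih =>
    obtain ⟨s, hs⟩ : S.Nonempty := Finset.card_pos.1 (by omega)
    obtain ⟨p⟩ := hG.preconnected s v
    obtain ⟨e, -, he₁, he₂⟩ := p.exists_boundary_dart (S : Set V) hs hv
    have hadj := e.adj
    generalize e.fst = u at *
    generalize e.snd = w at *
    rw [Finset.mem_coe] at he₁ he₂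
    have key : ∀ c : ℤ, {f : V → ℤ | (∀ a b, G.Adj a b → |f a - f b| = 1) ∧
        ∀ t ∉ S.erase u, f t = Function.update g u c t}.encard ≤ 2 ^ n := fun c =>
      ih (S.erase u) (fun h => hv (Finset.mem_of_mem_erase h)) _
        (by rw [Finset.card_erase_of_mem he₁]; omega)
    have hsub : {f : V → ℤ | (∀ a b, G.Adj a b → |f a - f b| = 1) ∧ ∀ u ∉ S, f u = g u} ⊆
        {f : V → ℤ | (∀ a b, G.Adj a b → |f a - f b| = 1) ∧
          ∀ t ∉ S.erase u, f t = Function.update g u (g w + 1) t} ∪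
        {f : V → ℤ | (∀ a b, G.Adj a b → |f a - f b| = 1) ∧
          ∀ t ∉ S.erase u, f t = Function.update g u (g w - 1) t} := by
      rintro f ⟨hf, hfg⟩
      have hw := hfg w he₂
      have hval : ∀ c, f u = c → ∀ t ∉ S.erase u, f t = Function.update g u c t := by
        intro c hc t ht
        by_cases htu : t = u
        · subst htu
          simpa using hc
        · rw [Function.update_of_ne htu]
          exact hfg t fun h => ht (Finset.mem_erase.2 ⟨htu, h⟩)
      rcases (abs_eq (by norm_num)).1 (hf u w hadj) with h | h
      · exact Or.inl ⟨hf, hval _ (by omega)⟩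
      · exact Or.inr ⟨hf, hval _ (by omega)⟩
    refine ((Set.encard_le_encard hsub).trans (Set.encard_union_le _ _)).trans ?_
    rw [pow_succ, mul_two]
    exact add_le_add (key _) (key _)

lemma finite_ZHomSet [Fintype V] (hG : G.Connected) (v : V) : (ZHomSet G v).Finite := by
  classical
  have h := encard_extensions_le hG v (Finset.univ.erase v) (by simp) (fun _ => 0)
  refine (Set.finite_of_encard_le_coe (k := 2 ^ (Finset.univ.erase v).card)
    (by exact_mod_cast h)).subset ?_
  rintro f ⟨hf, hv⟩
  refine ⟨hf, fun u hu => ?_⟩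
  have : u = v := by simpa using hu
  rw [this, hv]

/-- `f` reaches height `k` at `x` over some vertex of the sphere of radius `k` around `x`. -/
def Peak (G : SimpleGraph V) (k : ℕ) (x : V) (f : V → ℤ) : Prop :=
  ∃ w, G.dist x w = k ∧ (k : ℤ) ≤ f x - f w

/-- A homomorphism can be modified inside a ball so as to have a peak at its centre. -/
lemma exists_peak [Finite V] (hG : G.Connected) (hf : ∀ a b, G.Adj a b → |f a - f b| = 1)
    {k : ℕ} {x v : V} (hv : k ≤ G.dist x v) :
    ∃ g : V → ℤ, (∀ a b, G.Adj a b → |g a - g b| = 1) ∧ (∀ u, k ≤ G.dist x u → g u = f u) ∧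
      Peak G k x g := by
  obtain ⟨s, hs, -⟩ := exists_dist_eq hG hv
  obtain ⟨w, hw, hmin⟩ := (Set.toFinite {w | G.dist x w = k}).exists_minimalFor f _ ⟨s, hs⟩
  have hmin' : ∀ t, G.dist x t = k → f w ≤ f t := fun t ht =>
    (le_total (f w) (f t)).elim id fun h => hmin ht h
  have hw' : G.dist x w = k := hw
  have hout : ∀ u, k ≤ G.dist x u → max (f u) (f w + k - G.dist x u) = f u := by
    intro u hu
    obtain ⟨t, ht, htu⟩ := exists_dist_eq hG hu
    have h1 := (abs_le.1 (dist_bound hG hf t u).1).2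
    have h2 := hmin' t ht
    exact max_eq_left (by omega)
  refine ⟨fun u => max (f u) (f w + k - G.dist x u), fun a b hab => ?_, hout, w, hw', ?_⟩
  · have h1 := (dist_bound hG hf x a).2
    have h2 := (dist_bound hG hf x b).2
    have h3 := (dist_bound hG hf x w).2
    have h4 := hG.dist_triangle (u := x) (v := a) (w := b)
    have h5 := hG.dist_triangle (u := x) (v := b) (w := a)
    rw [SimpleGraph.dist_eq_one_iff_adj.2 hab] at h4
    rw [SimpleGraph.dist_eq_one_iff_adj.2 hab.symm] at h5
    have h6 := (abs_eq (by norm_num)).1 (hf a b hab)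
    rw [abs_eq (by norm_num)]
    dsimp only
    omega
  · have := hout w hw'.ge
    dsimp only
    rw [this, SimpleGraph.dist_self]
    have := le_max_right (f x) (f w + k - (0 : ℕ))
    omega

/-- Forbidding one more peak loses a definite proportion of the homomorphisms. -/
lemma ncard_le_mul_ncard_peak [Fintype V] (hG : G.Connected) {v x : V} {k : ℕ}
    (hv : k ≤ G.dist x v) {A : Set (V → ℤ)} (hA : A ⊆ ZHomSet G v)
    (hclosed : ∀ f ∈ A, ∀ g ∈ ZHomSet G v, (∀ u, k ≤ G.dist x u → g u = f u) → g ∈ A) :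
    A.ncard ≤ 2 ^ ((maxDeg G + 1) ^ k) * {f ∈ A | Peak G k x f}.ncard := by
  classical
  have hfin := (finite_ZHomSet hG v).subset hA
  have hex : ∀ f : V → ℤ, ∃ g : V → ℤ, f ∈ A →
      g ∈ A ∧ (∀ u, k ≤ G.dist x u → g u = f u) ∧ Peak G k x g := by
    intro f
    by_cases hfA : f ∈ A
    · obtain ⟨g, hg, hgf, hp⟩ := exists_peak hG (hA hfA).1 hv
      exact ⟨g, fun _ => ⟨hclosed f hfA g ⟨hg, (hgf v hv).trans (hA hfA).2⟩ hgf, hgf, hp⟩⟩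
    · exact ⟨f, fun h => absurd h hfA⟩
  choose T hT using hex
  set B : Finset V := Finset.univ.filter fun u => G.dist x u < k with hB
  have hBcard : B.card ≤ (maxDeg G + 1) ^ k := by
    refine le_trans ?_ (card_closedBall_le hG x k)
    rw [← Set.ncard_coe_finset]
    refine Set.ncard_le_ncard (fun u hu => ?_) (Set.toFinite _)
    exact ((Finset.mem_filter.1 (Finset.mem_coe.1 hu)).2).le
  have hfiber : ∀ g ∈ hfin.toFinset.image T,
      (hfin.toFinset.filter fun f => T f = g).card ≤ 2 ^ ((maxDeg G + 1) ^ k) := by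
    intro g _
    have h := encard_extensions_le hG v B (by simp [hB, hv]) g
    have hsub : ((hfin.toFinset.filter fun f => T f = g : Finset (V → ℤ)) : Set (V → ℤ)) ⊆
        {f : V → ℤ | (∀ a b, G.Adj a b → |f a - f b| = 1) ∧ ∀ u ∉ B, f u = g u} := by
      intro f hf
      rw [Finset.mem_coe, Finset.mem_filter, Set.Finite.mem_toFinset] at hf
      refine ⟨(hA hf.1).1, fun u hu => ?_⟩
      rw [← hf.2]
      exact ((hT f hf.1).2.1 u (by simpa [hB] using hu)).symm
    have h2 := (Set.encard_le_encard hsub).trans h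
    rw [Set.encard_coe_eq_coe_finsetCard] at h2
    exact le_trans (by exact_mod_cast h2) (Nat.pow_le_pow_right (by norm_num) hBcard)
  rw [Set.ncard_eq_toFinset_card A hfin]
  refine (Finset.card_le_mul_card_image _ _ hfiber).trans (Nat.mul_le_mul_left _ ?_)
  rw [← Set.ncard_coe_finset]
  refine Set.ncard_le_ncard ?_ (hfin.subset fun f hf => hf.1)
  intro g hg
  obtain ⟨f, hf, rfl⟩ := Finset.mem_image.1 (Finset.mem_coe.1 hg)
  rw [Set.Finite.mem_toFinset] at hf
  exact ⟨(hT f hf).1, (hT f hf).2.2⟩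

lemma ncard_noPeak_le [Fintype V] (hG : G.Connected) {v : V} {k : ℕ} (S : Finset V)
    (hv : ∀ x ∈ S, k ≤ G.dist x v)
    (hsep : ∀ x ∈ S, ∀ y ∈ S, x ≠ y → 2 * k < G.dist x y) :
    ({f ∈ ZHomSet G v | ∀ x ∈ S, ¬ Peak G k x f}.ncard : ℝ) ≤
      (1 - 1 / 2 ^ ((maxDeg G + 1) ^ k)) ^ S.card * (ZHomSet G v).ncard := by
  classical
  induction S using Finset.induction_on with
  | empty => simp
  | insert x S hx ih =>
    have ih := ih (fun y hy => hv y (Finset.mem_insert_of_mem hy)) fun y hy z hz =>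
      hsep y (Finset.mem_insert_of_mem hy) z (Finset.mem_insert_of_mem hz)
    set A := {f ∈ ZHomSet G v | ∀ x ∈ S, ¬ Peak G k x f} with hA
    have hfin : A.Finite := (finite_ZHomSet hG v).subset fun f hf => hf.1
    have hstep := ncard_le_mul_ncard_peak hG (hv x (Finset.mem_insert_self _ _))
      (A := A) (fun f hf => hf.1) (by
        intro f hf g hg hgf
        refine ⟨hg, fun y hy hpeak => hf.2 y hy ?_⟩
        obtain ⟨w, hw, hpw⟩ := hpeak
        have h1 := hsep x (Finset.mem_insert_self _ _) y (Finset.mem_insert_of_mem hy)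
          (fun h => hx (h ▸ hy))
        have h2 := hG.dist_triangle (u := x) (v := w) (w := y)
        rw [SimpleGraph.dist_comm (u := w)] at h2
        refine ⟨w, hw, ?_⟩
        rw [← hgf w (by omega), ← hgf y (by omega)]
        exact hpw)
    have hsplit : {f ∈ ZHomSet G v | ∀ y ∈ insert x S, ¬ Peak G k y f}.ncard +
        {f ∈ A | Peak G k x f}.ncard = A.ncard := by
      rw [← Set.ncard_union_eq _ (hfin.subset _) (hfin.subset fun f hf => hf.1)]
      · congr 1
        ext f
        simp only [hA, Finset.forall_mem_insert, Set.mem_union, Set.mem_ofPred_eq]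
        tauto
      · rw [Set.disjoint_left]
        rintro f hf ⟨-, h⟩
        exact hf.2 x (Finset.mem_insert_self _ _) h
      · rintro f ⟨hf, h⟩
        exact ⟨hf, fun y hy => h y (Finset.mem_insert_of_mem hy)⟩
    rw [Finset.card_insert_of_notMem hx, pow_succ]
    set q : ℝ := 2 ^ ((maxDeg G + 1) ^ k) with hq
    have hq1 : 1 ≤ q := one_le_pow₀ (by norm_num)
    have hstep' : (A.ncard : ℝ) ≤ q * ({f ∈ A | Peak G k x f}.ncard : ℝ) := by
      rw [hq]
      exact_mod_cast hstep
    have hsplit' : ({f ∈ ZHomSet G v | ∀ y ∈ insert x S, ¬ Peak G k y f}.ncard : ℝ) +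
        {f ∈ A | Peak G k x f}.ncard = A.ncard := by exact_mod_cast hsplit
    have h1 : 0 ≤ 1 - 1 / q := by
      rw [sub_nonneg, div_le_one (by positivity)]
      exact hq1
    have h2 : (A.ncard : ℝ) * (1 / q) ≤ {f ∈ A | Peak G k x f}.ncard := by
      rw [mul_one_div, div_le_iff₀ (by positivity), mul_comm]
      exact hstep'
    calc ({f ∈ ZHomSet G v | ∀ y ∈ insert x S, ¬ Peak G k y f}.ncard : ℝ)
        ≤ (1 - 1 / q) * A.ncard := by linarith
      _ ≤ (1 - 1 / q) * ((1 - 1 / q) ^ S.card * (ZHomSet G v).ncard) :=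
        mul_le_mul_of_nonneg_left ih h1
      _ = _ := by ring

/-- Quantitative bound on the probability of having range at most `k`. -/
lemma ncard_range_le_div_le [Fintype V] (hG : G.Connected) (v : V) (k : ℕ)
    (hne : (ZHomSet G v).Nonempty) :
    ({f ∈ ZHomSet G v | (Set.range f).ncard ≤ k}.ncard : ℝ) / (ZHomSet G v).ncard ≤
      Real.exp (-((Fintype.card V / (((maxDeg G : ℝ) + 1) ^ k) ^ 2 - 1) /
        2 ^ ((maxDeg G + 1) ^ k))) := by
  classical
  obtain ⟨S, hvS, hsep, hcard⟩ := exists_separated hG v (2 * k)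
  have hfin := finite_ZHomSet hG v
  have hpos : (0 : ℝ) < (ZHomSet G v).ncard := by
    exact_mod_cast (Set.ncard_pos hfin).2 hne
  have h1 := ncard_noPeak_le hG (S.erase v) (v := v) (k := k)
    (fun x hx => by
      have := hsep x (Finset.mem_of_mem_erase hx) v hvS (Finset.ne_of_mem_erase hx)
      omega)
    (fun x hx y hy => hsep x (Finset.mem_of_mem_erase hx) y (Finset.mem_of_mem_erase hy))
  have h2 : {f ∈ ZHomSet G v | (Set.range f).ncard ≤ k}.ncard ≤
      {f ∈ ZHomSet G v | ∀ x ∈ S.erase v, ¬ Peak G k x f}.ncard := by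
    refine Set.ncard_le_ncard ?_ (hfin.subset fun f hf => hf.1)
    rintro f ⟨hf, hr⟩
    refine ⟨hf, fun x _ hp => ?_⟩
    obtain ⟨w, -, hw⟩ := hp
    exact absurd (lt_ncard_range hG hf.1 hw) (by omega)
  rw [div_le_iff₀ hpos]
  refine ((Nat.cast_le.2 h2).trans h1).trans (mul_le_mul_of_nonneg_right ?_ hpos.le)
  set q : ℝ := 2 ^ ((maxDeg G + 1) ^ k) with hq
  have hq1 : 1 ≤ q := one_le_pow₀ (by norm_num)
  have h3 : 0 ≤ 1 - 1 / q := by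
    rw [sub_nonneg, div_le_one (by positivity)]
    exact hq1
  refine (pow_le_pow_left₀ h3 (Real.one_sub_le_exp_neg _) _).trans ?_
  rw [← Real.exp_nat_mul, Real.exp_le_exp, mul_neg, neg_le_neg_iff, mul_one_div]
  refine div_le_div_of_nonneg_right ?_ (by positivity)
  rw [Finset.card_erase_of_mem hvS, Nat.cast_sub (Finset.card_pos.2 ⟨v, hvS⟩), Nat.cast_one]
  refine sub_le_sub_right ?_ 1
  rw [div_le_iff₀ (by positivity), ← pow_mul, mul_comm k]
  exact_mod_cast hcard

/-- The threshold on the range is chosen so that balls of that radius have at most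
logarithmic size. -/
lemma succ_pow_floor_le (d : ℕ) {L : ℝ} (hL : 2 ≤ L) :
    ((d : ℝ) + 1) ^ ⌊(Real.logb 2 L - 1) / Real.logb 2 (d + 1)⌋₊ ≤ L / 2 := by
  have hnum : 0 ≤ Real.logb 2 L - 1 := by
    rw [sub_nonneg, Real.le_logb_iff_rpow_le (by norm_num) (by linarith)]
    simpa using hL
  rcases Nat.eq_zero_or_pos d with rfl | hd
  · simp
    linarith
  · have hd' : (1 : ℝ) < d + 1 := by
      have : (0 : ℝ) < d := by exact_mod_cast hd
      linarith
    have hlog : 0 < Real.logb 2 ((d : ℝ) + 1) := Real.logb_pos (by norm_num) hd'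
    have hfl := Nat.floor_le (div_nonneg hnum hlog.le)
    rw [le_div_iff₀ hlog] at hfl
    set k := ⌊(Real.logb 2 L - 1) / Real.logb 2 ((d : ℝ) + 1)⌋₊
    rw [← Real.logb_le_logb (b := 2) (by norm_num) (by positivity) (by linarith), Real.logb_pow,
      Real.logb_div (by linarith) (by norm_num), Real.logb_self_eq_one (by norm_num)]
    exact hfl

lemma tendsto_two_rpow_half_div_sq :
    Tendsto (fun L : ℝ => 4 * ((2 : ℝ) ^ (L / 2) / L ^ 2) - 1) atTop atTop := by
  refine tendsto_atTop_add_const_right _ _ (Tendsto.const_mul_atTop (by norm_num) ?_)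
  have h := tendsto_exp_mul_div_rpow_atTop 2 (Real.log 2 / 2)
    (div_pos (Real.log_pos (by norm_num)) (by norm_num))
  refine h.congr fun L => ?_
  rw [Real.rpow_two, Real.rpow_def_of_pos (by norm_num)]
  ring_nf

end ZHom

theorem stmt1 (N : ℕ → ℕ) (hN : Tendsto N atTop atTop)
    (G : ∀ n, SimpleGraph (Fin (N n))) (hconn : ∀ n, (G n).Connected)
    (v : ∀ n, Fin (N n))
    (hne : ∀ n, (ZHomSet (G n) (v n)).Nonempty) :
    Tendsto (fun n =>
      (({f ∈ ZHomSet (G n) (v n) |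
          ((Set.range f).ncard : ℝ) ≤
            (Real.logb 2 (Real.logb 2 (N n)) - 1) / Real.logb 2 (maxDeg (G n) + 1)}).ncard : ℝ)
        / ((ZHomSet (G n) (v n)).ncard : ℝ))
      atTop (nhds 0) := by
  have hNR : Tendsto (fun n => (N n : ℝ)) atTop atTop := tendsto_natCast_atTop_atTop.comp hN
  have hL : Tendsto (fun n => Real.logb 2 (N n)) atTop atTop :=
    (Real.tendsto_logb_atTop (by norm_num)).comp hNR
  have hlim := Real.tendsto_exp_neg_atTop_nhds_zero.comp
    (ZHom.tendsto_two_rpow_half_div_sq.comp hL)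
  refine squeeze_zero' (Eventually.of_forall fun n => by positivity) ?_ hlim
  filter_upwards [hL.eventually_ge_atTop 2, hNR.eventually_gt_atTop 0] with n hLn hNpos
  set L := Real.logb 2 (N n) with hLdef
  set K := (Real.logb 2 L - 1) / Real.logb 2 (maxDeg (G n) + 1) with hK
  have hD := ZHom.succ_pow_floor_le (maxDeg (G n)) hLn
  rw [← hK] at hD
  have hbound := ZHom.ncard_range_le_div_le (hconn n) (v n) ⌊K⌋₊ (hne n)
  rw [Fintype.card_fin] at hbound
  refine le_trans (div_le_div_of_nonneg_right ?_ (by positivity)) (hbound.trans ?_)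
  · refine Nat.cast_le.2 (Set.ncard_le_ncard ?_
      ((ZHom.finite_ZHomSet (hconn n) (v n)).subset fun f hf => hf.1))
    exact fun f hf => ⟨hf.1, Nat.le_floor hf.2⟩
  · simp only [Function.comp_apply, ← hLdef]
    rw [Real.exp_le_exp, neg_le_neg_iff]
    have hNL : (N n : ℝ) = 2 ^ L := (Real.rpow_logb (by norm_num) (by norm_num) hNpos).symm
    set D : ℝ := ((maxDeg (G n) : ℝ) + 1) ^ ⌊K⌋₊ with hDdef
    have hDpos : 0 < D := by positivity
    have hq : (2 : ℝ) ^ ((maxDeg (G n) + 1) ^ ⌊K⌋₊) = 2 ^ D := by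
      rw [← Real.rpow_natCast]
      push_cast
      rfl
    have hroot : (2 : ℝ) ^ L = 2 ^ (L / 2) * 2 ^ (L / 2) := by
      rw [← Real.rpow_add (by norm_num), add_halves]
    have hq2 : (2 : ℝ) ^ D ≤ 2 ^ (L / 2) := Real.rpow_le_rpow_of_exponent_le (by norm_num) hD
    have hq1 : (1 : ℝ) ≤ 2 ^ D := Real.one_le_rpow (by norm_num) hDpos.le
    rw [hq, hNL, hroot, sub_div]
    set s : ℝ := 2 ^ (L / 2)
    set q : ℝ := 2 ^ D
    have hs : 0 < s := by linarith
    refine sub_le_sub ?_ ((div_le_one (by linarith)).2 hq1)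
    have hDD : D ^ 2 ≤ (L / 2) ^ 2 := pow_le_pow_left₀ hDpos.le hD 2
    calc 4 * (s / L ^ 2) = s * s / (L / 2) ^ 2 / s := by
          field_simp
          ring
      _ ≤ s * s / D ^ 2 / q := by gcongr
end

section
/- For even n ∈ ℕ, let T_n be the n × n torus: the graph with vertex set ℤ_n × ℤ_n and edges (i,j) ∼ (i+1,j) and (i,j) ∼ (i,j+1) for all i, j ∈ ℤ_n (addition modulo n). Let f_n be chosen uniformly at random from Hom_{(0,0)}(T_n, ℤ). Then Pr[R(f_n) > (1/2)·(log₂ n)^{1/2}] = 1 − o(1) as n → ∞. -/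
open Filter

/-- The `n × n` torus: vertex set `ℤ_n × ℤ_n` with edges
`(i,j) ∼ (i+1,j)` and `(i,j) ∼ (i,j+1)` (addition modulo `n`). -/
def torus (n : ℕ) : SimpleGraph (ZMod n × ZMod n) :=
  SimpleGraph.fromRel fun a b => (a.1 + 1 = b.1 ∧ a.2 = b.2) ∨ (a.1 = b.1 ∧ a.2 + 1 = b.2)

/-- If each of `m` events can be destroyed by a self-map of `H` with fibres of size at most `N`
that preserves all earlier events, then the joint probability of the events
is at most `(1 - 1 / N) ^ m`. -/
lemma card_filter_forall_le {α : Type*} (H : Finset α) (P : ℕ → α → Prop) (N m : ℕ)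
    (Φ : ℕ → α → α) (hmaps : ∀ k < m, ∀ f ∈ H, Φ k f ∈ H)
    (hinv : ∀ k < m, ∀ j < k, ∀ f ∈ H, P j f → P j (Φ k f))
    (hnot : ∀ k < m, ∀ f ∈ H, ¬ P k (Φ k f))
    (hfib : ∀ k < m, ∀ g ∈ H, {f ∈ (H : Set α) | Φ k f = g}.ncard ≤ N) (hN : 0 < N) :
    ({f ∈ (H : Set α) | ∀ k < m, P k f}.ncard : ℝ) ≤ (1 - 1 / (N : ℝ)) ^ m * H.card := by
  classical
  have key : ∀ t ≤ m, (((H.filter fun f => ∀ k < t, P k f).card : ℕ) : ℝ)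
      ≤ (1 - 1 / (N : ℝ)) ^ t * H.card := by
    intro t
    induction t with
    | zero => simp
    | succ t ih =>
      intro ht
      have htm : t < m := ht
      have ih' := ih htm.le
      set B := H.filter fun f => ∀ k < t, P k f with hB
      have hsplit : B.card = (B.filter fun f => P t f).card + (B.filter fun f => ¬ P t f).card :=
        (Finset.card_filter_add_card_filter_not _).symm
      have hnext : (H.filter fun f => ∀ k < t + 1, P k f) = B.filter fun f => P t f := by
        ext f
        simp only [hB, Finset.mem_filter, and_assoc, Nat.forall_lt_succ_right]
      have hle : B.card ≤ N * (B.filter fun f => ¬ P t f).card := by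
        refine Finset.card_le_mul_card_image_of_maps_to (f := Φ t) ?_ N ?_
        · intro f hf
          simp only [hB, Finset.mem_filter] at hf ⊢
          exact ⟨⟨hmaps t htm f hf.1, fun k hk => hinv t htm k hk f hf.1 (hf.2 k hk)⟩,
            hnot t htm f hf.1⟩
        · intro g hg
          have hgH : g ∈ H := (Finset.mem_filter.1 (Finset.mem_filter.1 hg).1).1
          refine le_trans ?_ (hfib t htm g hgH)
          rw [← Set.ncard_coe_finset]
          refine Set.ncard_le_ncard ?_ (H.finite_toSet.subset fun f hf => hf.1)
          intro f hf
          simp only [hB, Finset.coe_filter, Set.mem_ofPred_eq, Finset.mem_filter] at hf ⊢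
          exact ⟨hf.1.1, hf.2⟩
      rw [hnext]
      have hNR : (0 : ℝ) < N := by exact_mod_cast hN
      have hNR1 : (1 : ℝ) ≤ N := by exact_mod_cast hN
      have h1 : (B.card : ℝ) / N ≤ ((B.filter fun f => ¬ P t f).card : ℝ) := by
        rw [div_le_iff₀ hNR, mul_comm]
        exact_mod_cast hle
      have h2 : (B.card : ℝ) =
          (B.filter fun f => P t f).card + (B.filter fun f => ¬ P t f).card := by
        exact_mod_cast hsplit
      have h3 : (0 : ℝ) ≤ 1 - 1 / N := by
        rw [sub_nonneg, div_le_one hNR]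
        exact hNR1
      calc ((B.filter fun f => P t f).card : ℝ) ≤ (1 - 1 / (N : ℝ)) * B.card := by
            rw [sub_mul, one_mul, one_div_mul_eq_div]
            linarith
        _ ≤ (1 - 1 / (N : ℝ)) * ((1 - 1 / (N : ℝ)) ^ t * H.card) := by gcongr
        _ = _ := by ring
  have := key m le_rfl
  rw [← Set.ncard_coe_finset] at this
  simpa using this

/-- In a connected graph, at most `2 ^ |A|` homomorphisms have prescribed values off a proper
vertex subset `A`. -/
lemma encard_hom_extension_le {V : Type*} {G : SimpleGraph V} (hG : G.Connected) (A : Finset V) :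
    (∃ v, v ∉ A) → ∀ φ : V → ℤ,
    {f : V → ℤ | (∀ a b, G.Adj a b → |f a - f b| = 1) ∧ ∀ v ∉ A, f v = φ v}.encard
      ≤ 2 ^ A.card := by
  classical
  induction hs : A.card generalizing A with
  | zero =>
    intro _ φ
    rw [Finset.card_eq_zero] at hs
    subst hs
    rw [pow_zero, Set.encard_le_one_iff]
    intro f g hf hg
    funext v
    rw [hf.2 v (by simp), hg.2 v (by simp)]
  | succ s ih =>
    rintro ⟨u₀, hu₀⟩ φ
    obtain ⟨v₀, hv₀⟩ : A.Nonempty := by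
      rw [← Finset.card_pos]
      omega
    obtain ⟨p⟩ := hG.preconnected v₀ u₀
    obtain ⟨d, -, hdA, hdA'⟩ := p.exists_boundary_dart (A : Set V) hv₀ hu₀
    set v := d.fst with hv
    set u := d.snd with hu
    have huv : G.Adj v u := d.adj
    have hcard : (A.erase v).card = s := by
      rw [Finset.card_erase_of_mem (by simpa using hdA), hs]
      rfl
    have hne : ∃ w, w ∉ A.erase v := ⟨v, by simp⟩
    have h1 := ih _ hcard hne (Function.update φ v (φ u + 1))
    have h2 := ih _ hcard hne (Function.update φ v (φ u - 1))
    refine (Set.encard_le_encard ?_).trans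
      ((Set.encard_union_le _ _).trans ((add_le_add h1 h2).trans (by rw [pow_succ, mul_two])))
    rintro f ⟨hf, hfA⟩
    have hfu : f u = φ u := hfA u (by simpa using hdA')
    have hval : f v = φ u + 1 ∨ f v = φ u - 1 := by
      have := hf v u huv
      rw [hfu] at this
      rcases abs_eq (zero_le_one' ℤ) |>.1 this with h | h
      · left; omega
      · right; omega
    refine hval.imp (fun h => ⟨hf, fun w hw => ?_⟩) (fun h => ⟨hf, fun w hw => ?_⟩)
    all_goals
      by_cases hwv : w = v
      · subst hwv
        simpa using h
      · rw [Function.update_of_ne hwv]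
        exact hfA w fun hwA => hw (Finset.mem_erase.2 ⟨hwv, hwA⟩)

lemma finite_zHomSet {V : Type} [Finite V] {G : SimpleGraph V} (hG : G.Connected) (v0 : V) :
    (ZHomSet G v0).Finite := by
  classical
  have := Fintype.ofFinite V
  have h := encard_hom_extension_le hG (Finset.univ.erase v0) ⟨v0, by simp⟩ 0
  refine Set.finite_of_encard_le_coe (k := 2 ^ (Finset.univ.erase v0).card) ?_
  refine le_trans (Set.encard_le_encard ?_) (le_trans h (by norm_cast))
  rintro f ⟨hf, hf0⟩
  refine ⟨hf, fun v hv => ?_⟩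
  have : v = v0 := by simpa using hv
  simpa [this] using hf0

lemma even_hom_sub_add_length {V : Type*} {G : SimpleGraph V} {f : V → ℤ}
    (hf : ∀ a b, G.Adj a b → |f a - f b| = 1) {u v : V} (p : G.Walk u v) :
    Even (f u - f v + p.length) := by
  induction p with
  | nil => simp
  | @cons a b c hab p ih =>
    rw [SimpleGraph.Walk.length_cons]
    have := (abs_eq (zero_le_one' ℤ)).1 (hf a b hab)
    rw [Int.even_iff] at ih ⊢
    push_cast
    omega

/-- A homomorphism takes all intermediate values along a walk. -/
lemma Icc_subset_range_of_walk {V : Type*} {G : SimpleGraph V} {f : V → ℤ}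
    (hf : ∀ a b, G.Adj a b → |f a - f b| = 1) {u v : V} (p : G.Walk u v) :
    Set.Icc (f u) (f v) ⊆ Set.range f := by
  induction p with
  | nil =>
    rintro t ⟨h1, h2⟩
    exact ⟨_, le_antisymm h1 h2⟩
  | @cons a b c hab p ih =>
    rintro t ⟨h1, h2⟩
    rcases h1.eq_or_lt with h | h
    · exact ⟨a, h⟩
    · have := (abs_eq (zero_le_one' ℤ)).1 (hf a b hab)
      exact ih ⟨by omega, h2⟩

/-- Raising a homomorphism inside a ball of radius `r` so that its value at the centre exceeds its
minimum over `W` by at least `r`, where `W` contains the bounding sphere. -/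
lemma exists_hom_raise {V : Type*} [Finite V] {G : SimpleGraph V} (hG : G.Connected) {f : V → ℤ}
    (hf : ∀ a b, G.Adj a b → |f a - f b| = 1) (c : V) (r : ℕ) (hr : 0 < r) (W : Set V)
    (hW : W.Nonempty) (hWb : ∀ w ∈ W, r ≤ G.dist c w) (hbW : ∀ w, G.dist c w = r → w ∈ W) :
    ∃ g : V → ℤ, (∀ a b, G.Adj a b → |g a - g b| = 1) ∧ (∀ v, r ≤ G.dist c v → g v = f v) ∧
      ∃ w ∈ W, g w + r ≤ g c := by
  classical
  obtain ⟨w₀, hw₀, hmin⟩ := Set.exists_min_image W f W.toFinite hW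
  have hpar : ∀ v, Even (f c - f v + G.dist c v) := by
    intro v
    obtain ⟨p, hp⟩ := hG.exists_walk_length_eq_dist c v
    rw [← hp]
    exact even_hom_sub_add_length hf p
  obtain ⟨K, hK, hKpar, hK'⟩ : ∃ K : ℤ, f w₀ + r ≤ K ∧ Even (K - f c) ∧
      ∀ w ∈ W, G.dist c w = r → K ≤ f w + r := by
    by_cases h : Even (f w₀ + r - f c)
    · exact ⟨_, le_rfl, h, fun w hw _ => by have := hmin w hw; omega⟩
    · refine ⟨f w₀ + r + 1, by omega, ?_, fun w hw hd => ?_⟩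
      · rw [Int.not_even_iff] at h
        rw [Int.even_iff]
        omega
      · have h1 := hmin w hw
        have h2 := hpar w
        rw [hd] at h2
        rw [Int.not_even_iff] at h
        rw [Int.even_iff] at h2
        omega
  have hdist : ∀ a b, G.Adj a b → G.dist c a ≤ G.dist c b + 1 := by
    intro a b hab
    have := hG.dist_triangle (u := c) (v := b) (w := a)
    rwa [SimpleGraph.dist_eq_one_iff_adj.2 hab.symm] at this
  refine ⟨fun v => if G.dist c v < r then max (f v) (K - G.dist c v) else f v, ?_, ?_, w₀, hw₀, ?_⟩
  · intro a b hab
    have h1 := (abs_eq (zero_le_one' ℤ)).1 (hf a b hab)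
    have h2 := hdist a b hab
    have h3 := hdist b a hab.symm
    have h4 := Int.even_iff.1 (hpar a)
    have h5 := Int.even_iff.1 (hpar b)
    rw [Int.even_iff] at hKpar
    have h6 : G.dist c a = r → K ≤ f a + r := fun h => hK' a (hbW a h) h
    have h7 : G.dist c b = r → K ≤ f b + r := fun h => hK' b (hbW b h) h
    simp only
    rw [abs_eq (zero_le_one' ℤ)]
    split_ifs <;> omega
  · intro v hv
    simp [hv]
  · have h1 := hWb w₀ hw₀
    simp only [SimpleGraph.dist_self, hr, if_true, not_lt.2 h1, if_false]
    have := le_max_right (f c) (K - ((0 : ℕ) : ℤ))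
    push_cast at this ⊢
    omega

/-- If a finite connected graph contains `m` vertices at pairwise distance at least `2 * r`, all at
distance at least `r` from the root and with open `r`-balls of size at most `s`, then a uniform
homomorphism has range at most `r` with probability at most `(1 - 2 ^ (-s)) ^ m`. -/
lemma ncard_zHomSet_range_le {V : Type} [Finite V] {G : SimpleGraph V} (hG : G.Connected) (v0 : V)
    (r m s : ℕ) (hr : 0 < r) (c : ℕ → V) (hc0 : ∀ k < m, r ≤ G.dist (c k) v0)
    (hc : ∀ k < m, ∀ j < k, 2 * r ≤ G.dist (c k) (c j))
    (hs : ∀ k < m, {v | G.dist (c k) v < r}.ncard ≤ s) :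
    ({f ∈ ZHomSet G v0 | (Set.range f).ncard ≤ r}.ncard : ℝ)
      ≤ (1 - 1 / ((2 ^ s : ℕ) : ℝ)) ^ m * (ZHomSet G v0).ncard := by
  classical
  have := Fintype.ofFinite V
  set W : Set V := {w | ∀ k < m, r ≤ G.dist (c k) w} with hWdef
  have hc' : ∀ k < m, ∀ j < m, j ≠ k → 2 * r ≤ G.dist (c k) (c j) := by
    intro k hk j hj hjk
    rcases lt_or_gt_of_ne hjk with h | h
    · exact hc k hk j h
    · rw [SimpleGraph.dist_comm]
      exact hc j hj k h
  have hsphere : ∀ k < m, ∀ w, G.dist (c k) w ≤ r → ∀ j < m, j ≠ k → r ≤ G.dist (c j) w := by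
    intro k hk w hw j hj hjk
    have h1 := hc' k hk j hj hjk
    have h2 := hG.dist_triangle (u := c k) (v := w) (w := c j)
    rw [SimpleGraph.dist_comm (u := w)] at h2
    omega
  have hraise : ∀ k < m, ∀ f ∈ ZHomSet G v0, ∃ g ∈ ZHomSet G v0,
      (∀ v, r ≤ G.dist (c k) v → g v = f v) ∧ ∃ w ∈ W, g w + r ≤ g (c k) := by
    intro k hk f hf
    obtain ⟨g, hg, hgf, hgw⟩ := exists_hom_raise hG hf.1 (c k) r hr W ⟨v0, hc0⟩
      (fun w hw => hw k hk) (fun w hw j hj => by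
        by_cases hjk : j = k
        · rw [hjk, hw]
        · exact hsphere k hk w hw.le j hj hjk)
    exact ⟨g, ⟨hg, (hgf v0 (hc0 k hk)).trans hf.2⟩, hgf, hgw⟩
  choose! Φ hΦ hΦf hΦw using hraise
  have hfin := finite_zHomSet hG v0
  have main := card_filter_forall_le hfin.toFinset
    (fun k f => ∀ w ∈ W, f (c k) < f w + r) (2 ^ s) m Φ
    (fun k hk f hf => by simpa using hΦ k hk f (by simpa using hf))
    (fun k hk j hj f hf hP w hw => by
      rw [hΦf k hk f (by simpa using hf) w (hw k hk), hΦf k hk f (by simpa using hf) (c j)]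
      · exact hP w hw
      · have := hc k hk j hj
        omega)
    (fun k hk f hf hP => by
      obtain ⟨w, hw, hle⟩ := hΦw k hk f (by simpa using hf)
      exact absurd (hP w hw) (not_lt.2 hle))
    (fun k hk g hg => by
      have h := encard_hom_extension_le hG {v | G.dist (c k) v < r}.toFinset
        ⟨v0, by simpa using hc0 k hk⟩ g
      have hs' : {v | G.dist (c k) v < r}.toFinset.card ≤ s := by
        rw [← Set.ncard_eq_toFinset_card']
        exact hs k hk
      have hsub : {f ∈ (hfin.toFinset : Set (V → ℤ)) | Φ k f = g} ⊆
          {f : V → ℤ | (∀ a b, G.Adj a b → |f a - f b| = 1) ∧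
            ∀ v ∉ {v | G.dist (c k) v < r}.toFinset, f v = g v} := by
        rintro f ⟨hf, rfl⟩
        have hf' : f ∈ ZHomSet G v0 := by simpa using hf
        exact ⟨hf'.1, fun v hv => (hΦf k hk f hf' v (by simpa using hv)).symm⟩
      have h' := (Set.encard_le_encard hsub).trans h
      have h'' : {f ∈ (hfin.toFinset : Set (V → ℤ)) | Φ k f = g}.ncard
          ≤ 2 ^ {v | G.dist (c k) v < r}.toFinset.card := by
        rw [Set.ncard]
        refine ENat.toNat_le_of_le_natCast (h'.trans ?_)
        norm_cast
      exact h''.trans (Nat.pow_le_pow_right two_pos hs'))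
    (by positivity)
  rw [Set.ncard_eq_toFinset_card _ hfin]
  refine le_trans ?_ main
  norm_cast
  refine Set.ncard_le_ncard ?_ (hfin.subset fun f hf => by simpa using hf.1)
  rintro f ⟨hf, hfr⟩
  refine ⟨by simpa using hf, fun k hk w hw => ?_⟩
  by_contra! hle
  obtain ⟨p⟩ := hG.preconnected w (c k)
  have h1 := Set.ncard_le_ncard (Icc_subset_range_of_walk hf.1 p) (Set.toFinite _)
  rw [← Finset.coe_Icc, Set.ncard_coe_finset, Int.card_Icc] at h1
  omega

lemma torus_adj_iff {n : ℕ} (hn : 2 ≤ n) (a b : ZMod n × ZMod n) :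
    (torus n).Adj a b ↔ b = a + (1, 0) ∨ b = a + (0, 1) ∨ a = b + (1, 0) ∨ a = b + (0, 1) := by
  have : Fact (1 < n) := ⟨hn⟩
  obtain ⟨a1, a2⟩ := a
  obtain ⟨b1, b2⟩ := b
  simp only [torus, SimpleGraph.fromRel_adj, ne_eq, Prod.mk.injEq, Prod.mk_add_mk, add_zero]
  constructor
  · rintro ⟨-, (⟨rfl, rfl⟩ | ⟨rfl, rfl⟩) | (⟨rfl, rfl⟩ | ⟨rfl, rfl⟩)⟩ <;> simp
  · rintro (⟨rfl, rfl⟩ | ⟨rfl, rfl⟩ | ⟨rfl, rfl⟩ | ⟨rfl, rfl⟩) <;> simp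

lemma torus_connected {n : ℕ} (hn : 2 ≤ n) : (torus n).Connected := by
  have : NeZero n := ⟨by omega⟩
  have h1 : ∀ i : ℕ, (torus n).Reachable 0 ((i : ZMod n), 0) := by
    intro i
    induction i with
    | zero => simp [← Prod.zero_eq_mk]
    | succ i ih =>
      refine ih.trans (SimpleGraph.Adj.reachable ?_)
      rw [torus_adj_iff hn]
      simp
  have h2 : ∀ i j : ℕ, (torus n).Reachable 0 ((i : ZMod n), (j : ZMod n)) := by
    intro i j
    induction j with
    | zero => simpa using h1 i
    | succ i ih =>
      refine ih.trans (SimpleGraph.Adj.reachable ?_)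
      rw [torus_adj_iff hn]
      simp
  have h3 : ∀ v, (torus n).Reachable 0 v := by
    rintro ⟨x, y⟩
    have := h2 x.val y.val
    rwa [ZMod.natCast_zmod_val, ZMod.natCast_zmod_val] at this
  exact { preconnected := fun u v => (h3 u).symm.trans (h3 v), nonempty := ⟨0⟩ }

lemma exists_int_coords_of_walk {n : ℕ} (hn : 2 ≤ n) {u v : ZMod n × ZMod n}
    (p : (torus n).Walk u v) :
    ∃ i j : ℤ, |i| ≤ p.length ∧ |j| ≤ p.length ∧ v = u + ((i : ZMod n), (j : ZMod n)) := by
  induction p with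
  | nil => exact ⟨0, 0, by simp⟩
  | @cons a b c hab p ih =>
    obtain ⟨i, j, hi, hj, rfl⟩ := ih
    simp only [SimpleGraph.Walk.length_cons, abs_le] at hi hj ⊢
    push_cast
    rw [torus_adj_iff hn] at hab
    rcases hab with rfl | rfl | rfl | rfl
    · refine ⟨i + 1, j, by omega, by omega, ?_⟩
      ext <;> push_cast <;> simp
      ring
    · refine ⟨i, j + 1, by omega, by omega, ?_⟩
      ext <;> push_cast <;> simp
      ring
    · refine ⟨i - 1, j, by omega, by omega, ?_⟩
      ext <;> simp
    · refine ⟨i, j - 1, by omega, by omega, ?_⟩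
      ext <;> simp

lemma exists_int_coords {n : ℕ} (hn : 2 ≤ n) (u v : ZMod n × ZMod n) :
    ∃ i j : ℤ, |i| ≤ (torus n).dist u v ∧ |j| ≤ (torus n).dist u v ∧
      v = u + ((i : ZMod n), (j : ZMod n)) := by
  obtain ⟨p, hp⟩ := (torus_connected hn).exists_walk_length_eq_dist u v
  rw [← hp]
  exact exists_int_coords_of_walk hn p

lemma ncard_torus_ball_le {n : ℕ} (hn : 2 ≤ n) (c : ZMod n × ZMod n) (r : ℕ) :
    {v | (torus n).dist c v < r}.ncard ≤ (2 * r - 1) ^ 2 := by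
  classical
  set I : Finset ℤ := Finset.Ioo (-(r : ℤ)) r with hI
  have hsub : {v | (torus n).dist c v < r} ⊆
      ((I ×ˢ I).image fun x : ℤ × ℤ => c + ((x.1 : ZMod n), (x.2 : ZMod n)) :
        Finset (ZMod n × ZMod n)) := by
    intro v hv
    obtain ⟨i, j, hi, hj, rfl⟩ := exists_int_coords hn c v
    simp only [Set.mem_ofPred_eq] at hv
    rw [abs_le] at hi hj
    rw [Finset.mem_coe, Finset.mem_image]
    refine ⟨(i, j), ?_, rfl⟩
    simp only [hI, Finset.mem_product, Finset.mem_Ioo]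
    omega
  refine (Set.ncard_le_ncard hsub (Finset.finite_toSet _)).trans ?_
  rw [Set.ncard_coe_finset]
  refine Finset.card_image_le.trans ?_
  rw [Finset.card_product, hI, Int.card_Ioo, sq]
  have : ((r : ℤ) - -r - 1).toNat = 2 * r - 1 := by omega
  rw [this]

/-- Vertices having a coordinate displacement `x` with `d ≤ |x| ≤ n - d` are at distance at least
`d` in the torus. -/
lemma le_dist_torus {n : ℕ} (hn : 2 ≤ n) (u v : ZMod n × ZMod n) (d : ℕ) (x : ℤ)
    (hx : v.1 = u.1 + (x : ZMod n) ∨ v.2 = u.2 + (x : ZMod n)) (hdx : (d : ℤ) ≤ |x|)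
    (hxd : |x| + d ≤ n) : d ≤ (torus n).dist u v := by
  by_contra! hlt
  have key : ∀ i : ℤ, |i| ≤ (torus n).dist u v → (i : ZMod n) = x → False := by
    intro i hi hix
    rw [ZMod.intCast_eq_intCast_iff_dvd_sub] at hix
    have h0 : x - i = 0 := Int.eq_zero_of_abs_lt_dvd hix (by
      have := abs_sub x i
      omega)
    have : x = i := by omega
    subst this
    omega
  obtain ⟨i, j, hi, hj, rfl⟩ := exists_int_coords hn u v
  rcases hx with hx | hx
  · exact key i hi (by simpa using hx)
  · exact key j hj (by simpa using hx)

lemma zHomSet_torus_nonempty {n : ℕ} (hn : 2 ≤ n) (he : Even n) :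
    (ZHomSet (torus n) (0, 0)).Nonempty := by
  have h2 : 2 ∣ n := he.two_dvd
  have hx : ∀ x : ZMod 2, |((x.val : ℕ) : ℤ) - (((x + 1).val : ℕ) : ℤ)| = 1 := by decide
  refine ⟨fun v => ((ZMod.castHom h2 (ZMod 2) (v.1 + v.2)).val : ℤ), ?_, by simp⟩
  intro a b hab
  rw [torus_adj_iff hn] at hab
  rcases hab with rfl | rfl | rfl | rfl
  · convert hx (ZMod.castHom h2 (ZMod 2) (a.1 + a.2)) using 5
    simp only [map_add, Prod.fst_add, Prod.snd_add, map_one, map_zero]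
    ring
  · convert hx (ZMod.castHom h2 (ZMod 2) (a.1 + a.2)) using 5
    simp only [map_add, Prod.fst_add, Prod.snd_add, map_one, map_zero]
    ring
  · rw [abs_sub_comm]
    convert hx (ZMod.castHom h2 (ZMod 2) (b.1 + b.2)) using 5
    simp only [map_add, Prod.fst_add, Prod.snd_add, map_one, map_zero]
    ring
  · rw [abs_sub_comm]
    convert hx (ZMod.castHom h2 (ZMod 2) (b.1 + b.2)) using 5
    simp only [map_add, Prod.fst_add, Prod.snd_add, map_one, map_zero]
    ring

/-- On the torus of side `n ≥ 2 ^ (4 r²)` the range is at most `r` with probability at most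
`exp (-r)`. -/
lemma ncard_zHomSet_torus_range_le {n r : ℕ} (hr : 0 < r) (hn : 2 ^ (4 * r ^ 2) ≤ n) :
    ({f ∈ ZHomSet (torus n) (0, 0) | (Set.range f).ncard ≤ r}.ncard : ℝ)
      ≤ Real.exp (-r) * (ZHomSet (torus n) (0, 0)).ncard := by
  have hexp : (2 * r - 1) ^ 2 + (4 * r - 1) = 4 * r ^ 2 := by
    obtain ⟨t, rfl⟩ : ∃ t, r = t + 1 := ⟨r - 1, by omega⟩
    have h1 : 2 * (t + 1) - 1 = 2 * t + 1 := by omega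
    have h2 : 4 * (t + 1) - 1 = 4 * t + 3 := by omega
    rw [h1, h2]
    ring
  have hpow : 2 * r * r ≤ 2 ^ (4 * r - 1) := by
    have h1 : r < 2 ^ r := Nat.lt_two_pow_self
    calc 2 * r * r ≤ 2 * 2 ^ r * 2 ^ r := by gcongr
      _ = 2 ^ (1 + r + r) := by ring
      _ ≤ 2 ^ (4 * r - 1) := Nat.pow_le_pow_right two_pos (by omega)
  set s := (2 * r - 1) ^ 2 with hs
  have hbig : r * 2 ^ s * (2 * r) ≤ n := by
    calc r * 2 ^ s * (2 * r) = 2 ^ s * (2 * r * r) := by ring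
      _ ≤ 2 ^ s * 2 ^ (4 * r - 1) := by gcongr
      _ = 2 ^ (4 * r ^ 2) := by rw [← pow_add, hexp]
      _ ≤ n := hn
  have hm : r * 2 ^ s ≤ n / (2 * r) := (Nat.le_div_iff_mul_le (by omega)).2 hbig
  have hrn : 2 * r ≤ n := by
    refine le_trans ?_ hbig
    exact Nat.le_mul_of_pos_left _ (by positivity)
  have hn2 : 2 ≤ n := by omega
  have : NeZero n := ⟨by omega⟩
  set m := n / (2 * r) with hmdef
  have hmn : 2 * r * m ≤ n := Nat.mul_div_le n (2 * r)
  have hmain := ncard_zHomSet_range_le (torus_connected hn2) (0, 0) r m s hr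
    (fun k => ((((2 * r * k : ℕ) : ℤ) : ZMod n), ((r : ℤ) : ZMod n)))
    (fun k hk => by
      refine le_dist_torus hn2 _ _ r (-r) (Or.inr ?_) ?_ ?_
      · push_cast
        ring
      · simp
      · simp only [abs_neg, Nat.abs_cast]
        omega)
    (fun k hk j hj => by
      refine le_dist_torus hn2 _ _ (2 * r) (-((2 * r * (k - j) : ℕ) : ℤ)) (Or.inl ?_) ?_ ?_
      · push_cast [Nat.cast_sub hj.le]
        ring
      · rw [abs_neg, Nat.abs_cast]
        exact_mod_cast Nat.le_mul_of_pos_right _ (by omega)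
      · rw [abs_neg, Nat.abs_cast]
        have : 2 * r * (k - j) + 2 * r ≤ 2 * r * m := by
          rw [← Nat.mul_succ]
          exact Nat.mul_le_mul_left _ (by omega)
        exact_mod_cast this.trans hmn)
    (fun k _ => ncard_torus_ball_le hn2 _ r)
  refine hmain.trans (mul_le_mul_of_nonneg_right ?_ (Nat.cast_nonneg _))
  have hN : (0 : ℝ) < ((2 ^ s : ℕ) : ℝ) := by positivity
  have hN1 : (1 : ℝ) ≤ ((2 ^ s : ℕ) : ℝ) := by exact_mod_cast Nat.one_le_two_pow
  calc (1 - 1 / ((2 ^ s : ℕ) : ℝ)) ^ m ≤ Real.exp (-(1 / ((2 ^ s : ℕ) : ℝ))) ^ m := by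
        refine pow_le_pow_left₀ ?_ (Real.one_sub_le_exp_neg _) m
        rw [sub_nonneg, div_le_one hN]
        exact hN1
    _ = Real.exp (-(m / ((2 ^ s : ℕ) : ℝ))) := by
        rw [← Real.exp_nat_mul]
        congr 1
        ring
    _ ≤ Real.exp (-r) := by
        rw [Real.exp_le_exp, neg_le_neg_iff, le_div_iff₀ hN]
        exact_mod_cast hm

theorem stmt2 :
    Tendsto (fun n =>
      (({f ∈ ZHomSet (torus n) (0, 0) |
          (1 / 2 : ℝ) * Real.sqrt (Real.logb 2 n) < ((Set.range f).ncard : ℝ)}).ncard : ℝ)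
        / ((ZHomSet (torus n) (0, 0)).ncard : ℝ))
      (atTop ⊓ Filter.principal {n : ℕ | Even n}) (nhds 1) := by
  set ρ : ℕ → ℕ := fun n => ⌊(1 / 2 : ℝ) * Real.sqrt (Real.logb 2 n)⌋₊ with hρ
  have hρtop : Tendsto ρ atTop atTop := by
    refine tendsto_nat_floor_atTop.comp (Tendsto.const_mul_atTop (by norm_num) ?_)
    exact Real.tendsto_sqrt_atTop.comp
      ((Real.tendsto_logb_atTop one_lt_two).comp tendsto_natCast_atTop_atTop)
  have hlow : Tendsto (fun n => 1 - Real.exp (-(ρ n : ℝ)))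
      (atTop ⊓ Filter.principal {n : ℕ | Even n}) (nhds 1) := by
    have h := (Real.tendsto_exp_neg_atTop_nhds_zero.comp
      (tendsto_natCast_atTop_atTop (R := ℝ))).comp hρtop
    simpa using (h.const_sub 1).mono_left inf_le_left
  have hev : ∀ᶠ n in atTop ⊓ Filter.principal {n : ℕ | Even n}, Even n ∧ 2 ≤ n ∧ 0 < ρ n := by
    refine (Filter.eventually_inf_principal.2 (Eventually.of_forall fun n hn => hn)).and ?_
    exact ((eventually_ge_atTop 2).and (hρtop.eventually_gt_atTop 0)).filter_mono inf_le_left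
  refine tendsto_of_tendsto_of_tendsto_of_le_of_le' hlow tendsto_const_nhds ?_ ?_
  · filter_upwards [hev] with n ⟨hne, hn2, hr⟩
    have : NeZero n := ⟨by omega⟩
    have hfin := finite_zHomSet (torus_connected hn2) (0, 0)
    have hpos : (0 : ℝ) < (ZHomSet (torus n) (0, 0)).ncard := by
      exact_mod_cast (Set.ncard_pos hfin).2 (zHomSet_torus_nonempty hn2 hne)
    have hbase : 2 ^ (4 * ρ n ^ 2) ≤ n := by
      have hn0 : (0 : ℝ) < n := by positivity
      have hn1 : (1 : ℝ) ≤ n := by exact_mod_cast one_le_two.trans hn2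
      have h1 : (ρ n : ℝ) ≤ (1 / 2 : ℝ) * Real.sqrt (Real.logb 2 n) :=
        Nat.floor_le (by positivity)
      have h2 : (4 * ρ n ^ 2 : ℝ) ≤ Real.logb 2 n := by
        have h3 := Real.sq_sqrt (Real.logb_nonneg one_lt_two hn1)
        nlinarith [Nat.cast_nonneg (α := ℝ) (ρ n)]
      rw [Real.le_logb_iff_rpow_le one_lt_two hn0] at h2
      exact_mod_cast h2
    have hbad := ncard_zHomSet_torus_range_le hr hbase
    rw [le_div_iff₀ hpos, sub_mul, one_mul, sub_le_iff_le_add]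
    refine le_trans ?_ (add_le_add_right hbad _)
    have hcover : ZHomSet (torus n) (0, 0) ⊆
        {f ∈ ZHomSet (torus n) (0, 0) |
          (1 / 2 : ℝ) * Real.sqrt (Real.logb 2 n) < ((Set.range f).ncard : ℝ)} ∪
        {f ∈ ZHomSet (torus n) (0, 0) | (Set.range f).ncard ≤ ρ n} := by
      intro f hf
      rcases lt_or_ge (ρ n) (Set.range f).ncard with h | h
      · exact Or.inl ⟨hf, (Nat.floor_lt' (by omega)).1 h⟩
      · exact Or.inr ⟨hf, h⟩
    exact_mod_cast (Set.ncard_le_ncard hcover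
      ((hfin.subset fun f hf => hf.1).union (hfin.subset fun f hf => hf.1))).trans
      (Set.ncard_union_le _ _)
  · filter_upwards [hev] with n ⟨hne, hn2, hr⟩
    have : NeZero n := ⟨by omega⟩
    refine div_le_one_of_le₀ ?_ (Nat.cast_nonneg _)
    exact_mod_cast Set.ncard_le_ncard (Set.sep_subset _ _)
      (finite_zHomSet (torus_connected hn2) (0, 0))
end

section
/- Let n ∈ ℕ be even and let k = k(n) ∈ ℕ satisfy k(n) ≥ 2·log₂ n + ψ(n), where ψ: ℕ → ℝ⁺ satisfies lim_{n→∞} ψ(n) = ∞. Let f_n be chosen uniformly at random from H_{n,k}. Then Pr[R(f_n) ≤ 3] = 1 − o(1) as n → ∞. -/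
open Filter

/-- The graph `C_{n,k}`: vertex set `ℤ_n × [k]`, with edges
`(i,s) ∼ (i+1,t)` for all `i ∈ ℤ_n` and `s,t ∈ [k]` (addition modulo `n`). -/
def Cnk (n k : ℕ) : SimpleGraph (ZMod n × Fin k) :=
  SimpleGraph.fromRel fun a b => a.1 + 1 = b.1

/-- `f` is a graph homomorphism to `ℤ`: it changes by exactly `1` along edges. -/
def IsHomZ {V : Type} (G : SimpleGraph V) (f : V → ℤ) : Prop :=
  ∀ a b, G.Adj a b → |f a - f b| = 1

/-- `H_{n,k}`: homomorphisms from `C_{n,k}` to `ℤ` with `f(0,1) = 0`. -/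
def Hnk (n k : ℕ) (hk : 0 < k) : Set (ZMod n × Fin k → ℤ) :=
  {f | IsHomZ (Cnk n k) f ∧ f (0, ⟨0, hk⟩) = 0}

/-- The `i`-layer is constant in `f`. -/
def LayerConst {n k : ℕ} (f : ZMod n × Fin k → ℤ) (i : ZMod n) : Prop :=
  ∀ s t, f (i, s) = f (i, t)

/-- `NC(f)`: the set of non-constant layers of `f`. -/
def NCset {n k : ℕ} (f : ZMod n × Fin k → ℤ) : Set (ZMod n) :=
  {i | ¬ LayerConst f i}

/-- `H⁰_{n,k}`: homomorphisms in `H_{n,k}` mapping the whole `0`-layer to `0`. -/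
def H0nk (n k : ℕ) (hk : 0 < k) : Set (ZMod n × Fin k → ℤ) :=
  {f | f ∈ Hnk n k hk ∧ ∀ s, f (0, s) = 0}

/-- The range size `R(f)`: the number of distinct values taken by `f`. -/
noncomputable def rngZ {V : Type} (f : V → ℤ) : ℕ := (Set.range f).ncard

/-! ### Structure of homomorphisms -/

section Structure

variable {n k : ℕ}

lemma ZMod.succ_induction [NeZero n] {P : ZMod n → Prop} (h0 : P 0)
    (hs : ∀ i, P i → P (i + 1)) (i : ZMod n) : P i := by
  have h : ∀ m : ℕ, P (m : ZMod n) := by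
    intro m
    induction m with
    | zero => simpa using h0
    | succ m ih => simpa using hs _ ih
  simpa using h i.val

lemma IsHomZ.step [Fact (1 < n)] {f : ZMod n × Fin k → ℤ} (hf : IsHomZ (Cnk n k) f)
    (i : ZMod n) (s t : Fin k) : |f (i, s) - f (i + 1, t)| = 1 := by
  apply hf
  simp [Cnk, SimpleGraph.fromRel_adj]

lemma IsHomZ.step_cases [Fact (1 < n)] {f : ZMod n × Fin k → ℤ} (hf : IsHomZ (Cnk n k) f)
    (i : ZMod n) (s t : Fin k) :
    f (i + 1, t) = f (i, s) + 1 ∨ f (i + 1, t) = f (i, s) - 1 := by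
  have := hf.step i s t
  rcases (abs_eq (by norm_num)).1 this with h | h <;> omega

/-- The layers on both sides of a non-constant layer carry one common value. -/
lemma IsHomZ.eq_of_not_layerConst [Fact (1 < n)] {f : ZMod n × Fin k → ℤ}
    (hf : IsHomZ (Cnk n k) f) {i : ZMod n} (hi : ¬ LayerConst f (i + 1)) (s t : Fin k) :
    f (i, s) = f (i + 1 + 1, t) := by
  simp only [LayerConst, not_forall] at hi
  obtain ⟨u, v, huv⟩ := hi
  have h1 := hf.step_cases i s u
  have h2 := hf.step_cases i s v
  have h3 := hf.step_cases (i + 1) u t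
  have h4 := hf.step_cases (i + 1) v t
  omega

lemma IsHomZ.layerConst_succ [Fact (1 < n)] {f : ZMod n × Fin k → ℤ}
    (hf : IsHomZ (Cnk n k) f) {i : ZMod n} (hi : ¬ LayerConst f i) :
    LayerConst f (i + 1) := by
  simp only [LayerConst, not_forall] at hi
  obtain ⟨u, v, huv⟩ := hi
  intro s t
  have h1 := hf.step_cases i u s
  have h2 := hf.step_cases i v s
  have h3 := hf.step_cases i u t
  have h4 := hf.step_cases i v t
  omega

/-- The positions `i` such that neither `i` nor `i + 1` belongs to `N`. -/
def gapSet [NeZero n] (N : Finset (ZMod n)) : Finset (ZMod n) :=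
  {i | i ∉ N ∧ i + 1 ∉ N}

/-- The set `N` contains no two cyclically consecutive elements. -/
def IsSparse (N : Finset (ZMod n)) : Prop := ∀ i ∈ N, i + 1 ∉ N

/-- The members of `Hnk n k hk` whose set of non-constant layers is `N`. -/
def fiberNC (hk : 0 < k) (N : Finset (ZMod n)) : Set (ZMod n × Fin k → ℤ) :=
  {f | f ∈ Hnk n k hk ∧ ∀ i, i ∈ N ↔ ¬ LayerConst f i}

lemma IsSparse.two_mul_card_add [NeZero n] {N : Finset (ZMod n)} (hN : IsSparse N) :
    2 * N.card + (gapSet N).card = n := by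
  have h1 : (Finset.univ.filter fun i : ZMod n => i + 1 ∈ N).card = N.card := by
    apply Finset.card_bij (fun i _ => i + 1)
    · intro i hi
      simpa using hi
    · intro i _ j _ hij
      simpa using hij
    · intro j hj
      exact ⟨j - 1, by simpa using hj, by simp⟩
  have h2 : Disjoint N (Finset.univ.filter fun i : ZMod n => i + 1 ∈ N) := by
    rw [Finset.disjoint_left]
    intro i hi
    simpa using hN i hi
  have h3 : gapSet N = (N ∪ (Finset.univ.filter fun i : ZMod n => i + 1 ∈ N))ᶜ := by
    ext i
    simp [gapSet]
  have h4 := Finset.card_add_card_compl (N ∪ (Finset.univ.filter fun i : ZMod n => i + 1 ∈ N))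
  rw [← h3, Finset.card_union_of_disjoint h2, h1, ZMod.card] at h4
  omega

lemma IsSparse.eq_of_gapSet_eq [NeZero n] {N M : Finset (ZMod n)} (hN : IsSparse N)
    (hM : IsSparse M) (h0 : (0 : ZMod n) ∈ N ↔ (0 : ZMod n) ∈ M) (h : gapSet N = gapSet M) :
    N = M := by
  ext i
  refine ZMod.succ_induction (P := fun i => i ∈ N ↔ i ∈ M) h0 ?_ i
  intro i hi
  have h1 := hN i
  have h2 := hM i
  have h3 : i ∈ gapSet N ↔ i ∈ gapSet M := by rw [h]
  simp only [gapSet, Finset.mem_filter, Finset.mem_univ, true_and] at h3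
  tauto

lemma isSparse_of_mem_fiberNC [Fact (1 < n)] {hk : 0 < k} {N : Finset (ZMod n)}
    {f : ZMod n × Fin k → ℤ} (hf : f ∈ fiberNC hk N) : IsSparse N := by
  intro i hi hi'
  exact (hf.2 _).1 hi' (hf.1.1.layerConst_succ ((hf.2 _).1 hi))

/-- A homomorphism is recorded by its increments along the gaps and by the shape of its
non-constant layers. -/
noncomputable def encodeNC [NeZero n] (hk : 0 < k) (N : Finset (ZMod n))
    (f : ZMod n × Fin k → ℤ) : (gapSet N → Bool) × (N → Fin k → Bool) :=
  (fun i => decide (f (i.1 + 1, ⟨0, hk⟩) = f (i.1, ⟨0, hk⟩) + 1),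
    fun i s => decide (f (i.1, s) = f (i.1 - 1, ⟨0, hk⟩) + 1))

lemma injOn_encodeNC [Fact (1 < n)] [NeZero n] (hk : 0 < k) (N : Finset (ZMod n)) :
    Set.InjOn (encodeNC hk N) (fiberNC hk N) := by
  intro f hf g hg hfg
  have hsp := isSparse_of_mem_fiberNC hf
  have hgap : ∀ i ∈ gapSet N, (f (i + 1, ⟨0, hk⟩) = f (i, ⟨0, hk⟩) + 1 ↔
      g (i + 1, ⟨0, hk⟩) = g (i, ⟨0, hk⟩) + 1) := by
    intro i hi
    simpa [encodeNC] using congrFun (congrArg Prod.fst hfg) ⟨i, hi⟩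
  have hlay : ∀ i, i + 1 ∈ N → ∀ s, (f (i + 1, s) = f (i, ⟨0, hk⟩) + 1 ↔
      g (i + 1, s) = g (i, ⟨0, hk⟩) + 1) := by
    intro i hi s
    simpa [encodeNC] using congrFun (congrFun (congrArg Prod.snd hfg) ⟨i + 1, hi⟩) s
  have hinc : ∀ i, f (i + 1, ⟨0, hk⟩) - f (i, ⟨0, hk⟩) = g (i + 1, ⟨0, hk⟩) - g (i, ⟨0, hk⟩) := by
    intro i
    have hf1 := hf.1.1.step_cases i ⟨0, hk⟩ ⟨0, hk⟩
    have hg1 := hg.1.1.step_cases i ⟨0, hk⟩ ⟨0, hk⟩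
    by_cases hi : i ∈ N
    · obtain ⟨j, rfl⟩ : ∃ j, i = j + 1 := ⟨i - 1, by simp⟩
      have h1 := hf.1.1.eq_of_not_layerConst ((hf.2 _).1 hi) ⟨0, hk⟩ ⟨0, hk⟩
      have h2 := hg.1.1.eq_of_not_layerConst ((hg.2 _).1 hi) ⟨0, hk⟩ ⟨0, hk⟩
      have h3 := hlay j hi ⟨0, hk⟩
      omega
    · by_cases hi' : i + 1 ∈ N
      · have h3 := hlay i hi' ⟨0, hk⟩
        omega
      · have h3 := hgap i (by simp [gapSet, hi, hi'])
        omega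
  have hbase : ∀ i, f (i, ⟨0, hk⟩) = g (i, ⟨0, hk⟩) := by
    refine ZMod.succ_induction ?_ ?_
    · rw [hf.1.2, hg.1.2]
    · intro i hi
      have := hinc i
      omega
  ext ⟨i, s⟩
  by_cases hi : i ∈ N
  · obtain ⟨j, rfl⟩ : ∃ j, i = j + 1 := ⟨i - 1, by simp⟩
    have h1 := hlay j hi s
    have h2 := hbase j
    have h3 := hf.1.1.step_cases j ⟨0, hk⟩ s
    have h4 := hg.1.1.step_cases j ⟨0, hk⟩ s
    omega
  · have h1 : LayerConst f i := by
      by_contra h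
      exact hi ((hf.2 i).2 h)
    have h2 : LayerConst g i := by
      by_contra h
      exact hi ((hg.2 i).2 h)
    rw [h1 s ⟨0, hk⟩, h2 s ⟨0, hk⟩, hbase]

lemma finite_fiberNC [Fact (1 < n)] [NeZero n] (hk : 0 < k) (N : Finset (ZMod n)) :
    (fiberNC hk N).Finite :=
  Set.Finite.of_finite_image (Set.toFinite _) (injOn_encodeNC hk N)

lemma ncard_fiberNC_le [Fact (1 < n)] [NeZero n] (hk : 0 < k) (N : Finset (ZMod n)) :
    (fiberNC hk N).ncard ≤ 2 ^ (gapSet N).card * (2 ^ k) ^ N.card := by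
  rw [← (injOn_encodeNC hk N).ncard_image]
  refine (Set.ncard_le_ncard (Set.subset_univ _)).trans_eq ?_
  rw [Set.ncard_univ, Nat.card_eq_fintype_card]
  simp

lemma exists_mem_fiberNC [NeZero n] {hk : 0 < k} {f : ZMod n × Fin k → ℤ}
    (hf : f ∈ Hnk n k hk) : ∃ N, f ∈ fiberNC hk N := by
  classical
  exact ⟨Finset.univ.filter fun i => ¬ LayerConst f i, hf, by simp⟩

lemma finite_Hnk [Fact (1 < n)] [NeZero n] (hk : 0 < k) : (Hnk n k hk).Finite := by
  refine (Set.finite_iUnion (finite_fiberNC (n := n) hk)).subset ?_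
  intro f hf
  simpa using exists_mem_fiberNC hf

/-- Without gaps, the constant layers share one value, so at most three values occur. -/
lemma rngZ_le_three_of_gapSet_eq_empty [Fact (1 < n)] [NeZero n] {hk : 0 < k}
    {N : Finset (ZMod n)} {f : ZMod n × Fin k → ℤ} (hf : f ∈ fiberNC hk N)
    (hN : gapSet N = ∅) : rngZ f ≤ 3 := by
  have hsp := isSparse_of_mem_fiberNC hf
  have hgap : ∀ i, i ∉ N → i + 1 ∈ N := by
    intro i hi
    by_contra h
    have : i ∈ gapSet N := by simp [gapSet, hi, h]
    simp [hN] at this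
  obtain ⟨c, hc⟩ : ∃ c : ℤ, ∀ i, (i ∉ N → f (i, ⟨0, hk⟩) = c) ∧
      (i ∈ N → f (i - 1, ⟨0, hk⟩) = c) := by
    refine ⟨if 0 ∈ N then f (0 - 1, ⟨0, hk⟩) else f (0, ⟨0, hk⟩), ZMod.succ_induction ?_ ?_⟩
    · constructor <;> intro h <;> simp [h]
    · intro i hi
      constructor
      · intro h
        have hiN : i ∈ N := by
          by_contra h'
          exact h (hgap i h')
        obtain ⟨j, rfl⟩ : ∃ j, i = j + 1 := ⟨i - 1, by simp⟩
        rw [← hf.1.1.eq_of_not_layerConst ((hf.2 _).1 hiN) ⟨0, hk⟩ ⟨0, hk⟩, ← hi.2 hiN]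
        simp
      · intro h
        rw [add_sub_cancel_right]
        exact hi.1 fun h' => hsp i h' h
  have hsub : Set.range f ⊆ (({c - 1, c, c + 1} : Finset ℤ) : Set ℤ) := by
    rintro _ ⟨⟨i, s⟩, rfl⟩
    simp only [Finset.coe_insert, Finset.coe_singleton, Set.mem_insert_iff,
      Set.mem_singleton_iff]
    by_cases hi : i ∈ N
    · obtain ⟨j, rfl⟩ : ∃ j, i = j + 1 := ⟨i - 1, by simp⟩
      have h1 := (hc _).2 hi
      rw [add_sub_cancel_right] at h1
      have h2 := hf.1.1.step_cases j ⟨0, hk⟩ s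
      omega
    · have h1 : LayerConst f i := by
        by_contra h
        exact hi ((hf.2 i).2 h)
      rw [h1 s ⟨0, hk⟩, (hc i).1 hi]
      simp
  unfold rngZ
  calc (Set.range f).ncard ≤ (({c - 1, c, c + 1} : Finset ℤ) : Set ℤ).ncard :=
        Set.ncard_le_ncard hsub (Finset.finite_toSet _)
    _ = ({c - 1, c, c + 1} : Finset ℤ).card := Set.ncard_coe_finset _
    _ ≤ 3 := Finset.card_le_three

end Structure

/-! ### Counting -/

section Counting

variable {n k : ℕ}

lemma ncard_rngZ_gt_three_le [Fact (1 < n)] [NeZero n] (hk : 0 < k) {Q : ℝ} (hQ : 0 ≤ Q)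
    (hQk : Q ^ 2 = 2 ^ k) :
    (({f ∈ Hnk n k hk | ¬ rngZ f ≤ 3}).ncard : ℝ) ≤ 2 * ((2 + Q) ^ n - Q ^ n) := by
  classical
  let T : Finset (Finset (ZMod n)) := {N | IsSparse N ∧ gapSet N ≠ ∅}
  let w : Finset (ZMod n) → ℝ := fun S => 2 ^ S.card * Q ^ (n - S.card)
  let φ : Finset (ZMod n) → Bool × Finset (ZMod n) := fun N => (decide (0 ∈ N), gapSet N)
  have hw : ∀ S, 0 ≤ w S := fun S => by positivity
  have hcover : {f ∈ Hnk n k hk | ¬ rngZ f ≤ 3} ⊆ ⋃ N ∈ T, fiberNC hk N := by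
    rintro f ⟨hf, hr⟩
    obtain ⟨N, hN⟩ := exists_mem_fiberNC hf
    simp only [Set.mem_iUnion]
    refine ⟨N, ?_, hN⟩
    simp only [T, Finset.mem_filter, Finset.mem_univ, true_and]
    exact ⟨isSparse_of_mem_fiberNC hN, fun h => hr (rngZ_le_three_of_gapSet_eq_empty hN h)⟩
  have hcard : ({f ∈ Hnk n k hk | ¬ rngZ f ≤ 3}).ncard ≤ ∑ N ∈ T, (fiberNC hk N).ncard :=
    (Set.ncard_le_ncard hcover
      (T.finite_toSet.biUnion fun N _ => finite_fiberNC hk N)).trans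
      (Finset.set_ncard_biUnion_le T _)
  have hfib : ∀ N ∈ T, ((fiberNC hk N).ncard : ℝ) ≤ w (gapSet N) := by
    intro N hN
    simp only [T, Finset.mem_filter, Finset.mem_univ, true_and] at hN
    have h1 := hN.1.two_mul_card_add
    have h2 : n - (gapSet N).card = 2 * N.card := by omega
    have h3 : ((fiberNC hk N).ncard : ℝ) ≤ 2 ^ (gapSet N).card * (2 ^ k) ^ N.card := by
      exact_mod_cast ncard_fiberNC_le hk N
    simpa only [w, h2, pow_mul, hQk] using h3
  have hinj : Set.InjOn φ T := by
    intro N hN M hM h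
    simp only [T, Finset.coe_filter, Finset.mem_univ, true_and, Set.mem_ofPred_eq] at hN hM
    simp only [φ, Prod.mk.injEq, decide_eq_decide] at h
    exact hN.1.eq_of_gapSet_eq hM.1 h.1 h.2
  have hsum : ∑ S : Finset (ZMod n), w S = (2 + Q) ^ n := by
    simpa [w, ZMod.card] using Fintype.sum_pow_mul_eq_add_pow (ZMod n) (2 : ℝ) Q
  calc (({f ∈ Hnk n k hk | ¬ rngZ f ≤ 3}).ncard : ℝ)
      ≤ ∑ N ∈ T, ((fiberNC hk N).ncard : ℝ) := by exact_mod_cast hcard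
    _ ≤ ∑ N ∈ T, w (φ N).2 := Finset.sum_le_sum hfib
    _ = ∑ p ∈ T.image φ, w p.2 := (Finset.sum_image (f := fun p => w p.2) hinj).symm
    _ ≤ ∑ p ∈ (Finset.univ : Finset Bool) ×ˢ (Finset.univ.erase (∅ : Finset (ZMod n))),
          w p.2 := by
        refine Finset.sum_le_sum_of_subset_of_nonneg ?_ fun _ _ _ => hw _
        intro p hp
        obtain ⟨N, hN, rfl⟩ := Finset.mem_image.1 hp
        simp only [T, Finset.mem_filter, Finset.mem_univ, true_and] at hN
        simp [φ, hN.2, em]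
    _ = 2 * ((2 + Q) ^ n - Q ^ n) := by
        rw [Finset.sum_product]
        simp only [Finset.sum_const, Finset.card_univ, Fintype.card_bool, nsmul_eq_mul]
        rw [Finset.sum_erase_eq_sub (Finset.mem_univ _), hsum]
        simp [w]

/-- All even layers are sent to `0`, the odd layers take arbitrary values `±1`. -/
def alternatingHom (m k : ℕ) (x : Fin m × Fin k → Bool) (p : ZMod (m + m) × Fin k) : ℤ :=
  if h : p.1.val % 2 = 1 ∧ p.1.val / 2 < m then
    if x (⟨p.1.val / 2, h.2⟩, p.2) then 1 else -1
  else 0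

lemma alternatingHom_mem {m k : ℕ} (hm : 0 < m) (hk : 0 < k) (x : Fin m × Fin k → Bool) :
    alternatingHom m k x ∈ Hnk (m + m) k hk := by
  have : NeZero (m + m) := ⟨by omega⟩
  have : Fact (1 < m + m) := ⟨by omega⟩
  have hstep : ∀ (i : ZMod (m + m)) s t,
      |alternatingHom m k x (i, s) - alternatingHom m k x (i + 1, t)| = 1 := by
    intro i s t
    have hi := ZMod.val_lt i
    have hv : (i + 1).val % 2 = (i.val + 1) % 2 := by
      rw [ZMod.val_add, ZMod.val_one, Nat.mod_mod_of_dvd _ ⟨m, by ring⟩]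
    have hi' := ZMod.val_lt (i + 1)
    unfold alternatingHom
    rcases Nat.mod_two_eq_zero_or_one i.val with h | h
    · have h1 : ¬ (i.val % 2 = 1 ∧ i.val / 2 < m) := by omega
      have h2 : (i + 1).val % 2 = 1 ∧ (i + 1).val / 2 < m := by omega
      rw [dif_neg h1, dif_pos h2]
      split_ifs <;> simp
    · have h1 : i.val % 2 = 1 ∧ i.val / 2 < m := by omega
      have h2 : ¬ ((i + 1).val % 2 = 1 ∧ (i + 1).val / 2 < m) := by omega
      rw [dif_pos h1, dif_neg h2]
      split_ifs <;> simp
  refine ⟨?_, by simp [alternatingHom]⟩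
  rintro ⟨i, s⟩ ⟨j, t⟩ hab
  simp only [Cnk, SimpleGraph.fromRel_adj] at hab
  rcases hab.2 with h | h
  · subst h
    exact hstep i s t
  · subst h
    rw [abs_sub_comm]
    exact hstep j t s

lemma injective_alternatingHom (m k : ℕ) : Function.Injective (alternatingHom m k) := by
  intro x y hxy
  ext ⟨j, s⟩
  have hj := j.isLt
  have hv : ((2 * j.val + 1 : ℕ) : ZMod (m + m)).val = 2 * j.val + 1 :=
    ZMod.val_natCast_of_lt (by omega)
  have h2 : (2 * j.val + 1) / 2 = j.val := by omega
  have h := congrFun hxy (((2 * j.val + 1 : ℕ) : ZMod (m + m)), s)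
  unfold alternatingHom at h
  simp only [hv, h2] at h
  have h3 : (2 * j.val + 1) % 2 = 1 ∧ j.val < m := by omega
  rw [dif_pos h3, dif_pos h3] at h
  cases hx : x (j, s) <;> cases hy : y (j, s) <;> simp [hx, hy] at h ⊢

lemma pow_le_ncard_Hnk {m k : ℕ} (hm : 0 < m) (hk : 0 < k) :
    (2 ^ k) ^ m ≤ (Hnk (m + m) k hk).ncard := by
  have : NeZero (m + m) := ⟨by omega⟩
  have : Fact (1 < m + m) := ⟨by omega⟩
  have h1 : (Set.range (alternatingHom m k)).ncard ≤ (Hnk (m + m) k hk).ncard :=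
    Set.ncard_le_ncard (by rintro _ ⟨x, rfl⟩; exact alternatingHom_mem hm hk x) (finite_Hnk hk)
  rw [← Set.image_univ, Set.ncard_image_of_injective _ (injective_alternatingHom m k),
    Set.ncard_univ, Nat.card_eq_fintype_card] at h1
  simpa [mul_comm m k, pow_mul] using h1

/-- The proportion of homomorphisms with at most three values is close to `1`. -/
lemma ratio_bounds (hn : Even n) (hn0 : 0 < n) (hk : 0 < k) {Q : ℝ} (hQ : 0 < Q)
    (hQk : Q ^ 2 = 2 ^ k) :
    1 - 2 * ((1 + 2 / Q) ^ n - 1) ≤ (({f ∈ Hnk n k hk | rngZ f ≤ 3}).ncard : ℝ)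
        / ((Hnk n k hk).ncard : ℝ) ∧
      (({f ∈ Hnk n k hk | rngZ f ≤ 3}).ncard : ℝ) / ((Hnk n k hk).ncard : ℝ) ≤ 1 := by
  obtain ⟨m, rfl⟩ := hn
  have : NeZero (m + m) := ⟨by omega⟩
  have : Fact (1 < m + m) := ⟨by omega⟩
  have hfin := finite_Hnk (n := m + m) hk
  have hsplit : ({f ∈ Hnk (m + m) k hk | rngZ f ≤ 3}).ncard +
      ({f ∈ Hnk (m + m) k hk | ¬ rngZ f ≤ 3}).ncard = (Hnk (m + m) k hk).ncard := by
    rw [← Set.ncard_union_eq ?_ (hfin.subset fun f h => h.1) (hfin.subset fun f h => h.1)]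
    · congr 1
      ext f
      simp only [Set.mem_union, Set.mem_ofPred_eq]
      tauto
    · rw [Set.disjoint_left]
      exact fun f h h' => h'.2 h.2
  have hsplit' : (({f ∈ Hnk (m + m) k hk | rngZ f ≤ 3}).ncard : ℝ) +
      ({f ∈ Hnk (m + m) k hk | ¬ rngZ f ≤ 3}).ncard = (Hnk (m + m) k hk).ncard := by
    exact_mod_cast hsplit
  have hbad := ncard_rngZ_gt_three_le (n := m + m) hk hQ.le hQk
  have hlow : Q ^ (m + m) ≤ ((Hnk (m + m) k hk).ncard : ℝ) := by
    rw [← two_mul, pow_mul, hQk, two_mul]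
    exact_mod_cast pow_le_ncard_Hnk (by omega) hk
  have hQn : 0 < Q ^ (m + m) := pow_pos hQ _
  have hpos := hQn.trans_le hlow
  have hpow : (2 + Q) ^ (m + m) = (1 + 2 / Q) ^ (m + m) * Q ^ (m + m) := by
    rw [← mul_pow]
    congr 1
    field_simp
    ring
  have hone : 1 ≤ (1 + 2 / Q) ^ (m + m) := one_le_pow₀ (by
    have : 0 < 2 / Q := by positivity
    linarith)
  constructor
  · rw [le_div_iff₀ hpos]
    rw [hpow] at hbad
    have := mul_le_mul_of_nonneg_left hlow (sub_nonneg.2 hone)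
    linarith
  · rw [div_le_one hpos]
    have : (0 : ℝ) ≤ ({f ∈ Hnk (m + m) k hk | ¬ rngZ f ≤ 3}).ncard := Nat.cast_nonneg _
    linarith

end Counting

/-- A lower bound on the width of the layers controls the weight of the exceptional maps. -/
lemma one_add_two_div_pow_le {n k : ℕ} {ψ : ℝ} (hn : 0 < n)
    (h : 2 * Real.logb 2 n + ψ ≤ (k : ℝ)) :
    (1 + 2 / (2 : ℝ) ^ ((k : ℝ) / 2)) ^ n ≤ Real.exp (2 * (2 : ℝ) ^ (-(ψ / 2))) := by
  have hn' : (0 : ℝ) < n := by exact_mod_cast hn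
  have h1 : (n : ℝ) * (2 : ℝ) ^ (ψ / 2) ≤ (2 : ℝ) ^ ((k : ℝ) / 2) := by
    calc (n : ℝ) * (2 : ℝ) ^ (ψ / 2) = (2 : ℝ) ^ (Real.logb 2 n + ψ / 2) := by
          rw [Real.rpow_add two_pos, Real.rpow_logb two_pos (by norm_num) hn']
      _ ≤ (2 : ℝ) ^ ((k : ℝ) / 2) :=
          Real.rpow_le_rpow_of_exponent_le one_le_two (by linarith)
  have hψ : (0 : ℝ) < (2 : ℝ) ^ (ψ / 2) := by positivity
  have h2 : (n : ℝ) * (2 / (2 : ℝ) ^ ((k : ℝ) / 2)) ≤ 2 * (2 : ℝ) ^ (-(ψ / 2)) := by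
    rw [Real.rpow_neg two_pos.le, mul_div_assoc', div_le_iff₀ (by positivity)]
    calc (n : ℝ) * 2 = 2 * ((2 : ℝ) ^ (ψ / 2))⁻¹ * (n * (2 : ℝ) ^ (ψ / 2)) := by field_simp
      _ ≤ _ := mul_le_mul_of_nonneg_left h1 (by positivity)
  calc (1 + 2 / (2 : ℝ) ^ ((k : ℝ) / 2)) ^ n
      ≤ Real.exp (2 / (2 : ℝ) ^ ((k : ℝ) / 2)) ^ n := by
        refine pow_le_pow_left₀ (by positivity) ?_ n
        rw [add_comm]
        exact Real.add_one_le_exp _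
    _ = Real.exp (n * (2 / (2 : ℝ) ^ ((k : ℝ) / 2))) := (Real.exp_nat_mul _ _).symm
    _ ≤ _ := Real.exp_le_exp.2 h2

theorem stmt5 (k : ℕ → ℕ) (hk : ∀ n, 0 < k n) (ψ : ℕ → ℝ)
    (hψpos : ∀ n, 0 < ψ n) (hψ : Tendsto ψ atTop atTop)
    (hkn : ∀ n : ℕ, Even n → 2 * Real.logb 2 n + ψ n ≤ (k n : ℝ)) :
    Tendsto (fun n =>
      (({f ∈ Hnk n (k n) (hk n) | rngZ f ≤ 3}).ncard : ℝ)
        / ((Hnk n (k n) (hk n)).ncard : ℝ))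
      (atTop ⊓ Filter.principal {n : ℕ | Even n}) (nhds 1) := by
  have hlim : Tendsto (fun n => 1 - 2 * (Real.exp (2 * (2 : ℝ) ^ (-(ψ n / 2))) - 1))
      (atTop ⊓ Filter.principal {n : ℕ | Even n}) (nhds 1) := by
    refine Tendsto.mono_left ?_ inf_le_left
    have h1 : Tendsto (fun n => (2 : ℝ) ^ (-(ψ n / 2))) atTop (nhds 0) :=
      (tendsto_rpow_atBot_of_base_gt_one 2 one_lt_two).comp
        (tendsto_neg_atTop_atBot.comp (hψ.atTop_div_const two_pos))
    have h2 := (Real.continuous_exp.tendsto _).comp (h1.const_mul 2)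
    simpa using ((h2.sub_const 1).const_mul 2).const_sub 1
  have hbounds : ∀ᶠ n in atTop ⊓ Filter.principal {n : ℕ | Even n},
      0 < n ∧ Even n := by
    rw [eventually_inf_principal]
    filter_upwards [eventually_gt_atTop 0] with n hn he using ⟨hn, he⟩
  have hQk : ∀ n, ((2 : ℝ) ^ ((k n : ℝ) / 2)) ^ 2 = 2 ^ k n := by
    intro n
    rw [← Real.rpow_natCast, ← Real.rpow_mul two_pos.le, ← Real.rpow_natCast]
    congr 1
    push_cast
    ring
  refine tendsto_of_tendsto_of_tendsto_of_le_of_le' hlim tendsto_const_nhds ?_ ?_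
  · filter_upwards [hbounds] with n hn
    have h1 := (ratio_bounds hn.2 hn.1 (hk n) (by positivity) (hQk n)).1
    have h2 := one_add_two_div_pow_le hn.1 (hkn n hn.2)
    linarith
  · filter_upwards [hbounds] with n hn
    exact (ratio_bounds hn.2 hn.1 (hk n) (by positivity) (hQk n)).2
end

section
/- Let n ≥ 4 be even and k ∈ ℕ. The map f ↦ (f_↓, f(1,1), (f(1,1)·f(0,2), f(1,1)·f(0,3), …, f(1,1)·f(0,k))), where f_↓(i,s) = f(i+1,s) − f(1,1) for i ∈ ℤ_{n−2} and s ∈ [k], is a bijection from H_{n,k} \ H⁰_{n,k} to H⁰_{n−2,k} × {1,−1} × ({0,2}^{k−1} \ {(0,…,0)}). Consequently, if f is chosen uniformly at random from H_{n,k} \ H⁰_{n,k}, then f_↓ is uniformly distributed in H⁰_{n−2,k}. -/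
open Filter

/-- The map `f ↦ f_↓`, `f_↓(i,s) = f(i+1,s) − f(1,1)`, defined for
`i ∈ ℤ_{n−2}`, `s ∈ [k]` (reading `i+1` in `ℤ_n`). -/
def fdown (n k : ℕ) (hk : 0 < k) (f : ZMod n × Fin k → ℤ) :
    ZMod (n - 2) × Fin k → ℤ :=
  fun p => f (((p.1.val + 1 : ℕ) : ZMod n), p.2) - f ((1 : ZMod n), ⟨0, hk⟩)

/-- The index `s + 1 ∈ [k]` for `s ∈ [k-1]`, i.e. the identification of
`{2, …, k}` with `[k-1]`. -/
def upIdx {k : ℕ} (s : Fin (k - 1)) : Fin k :=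
  ⟨s.val + 1, by have := s.isLt; omega⟩

theorem natCast_eq_neg_one {n j : ℕ} (h : j + 1 = n) : (j : ZMod n) = -1 := by
  rw [eq_neg_iff_add_eq_zero, ← Nat.cast_succ, Nat.succ_eq_add_one, h, ZMod.natCast_self]

theorem isHomZ_Cnk_iff {n k : ℕ} (hn : 2 ≤ n) (f : ZMod n × Fin k → ℤ) :
    IsHomZ (Cnk n k) f ↔ ∀ i s t, |f (i, s) - f (i + 1, t)| = 1 := by
  have : Fact (1 < n) := ⟨hn⟩
  constructor
  · intro h i s t
    refine h _ _ ?_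
    rw [Cnk, SimpleGraph.fromRel_adj]
    exact ⟨fun h => by simp at h, Or.inl rfl⟩
  · rintro h ⟨i, s⟩ ⟨j, t⟩ hab
    rw [Cnk, SimpleGraph.fromRel_adj] at hab
    obtain ⟨-, hij | hij⟩ := hab
    · obtain rfl : i + 1 = j := hij
      exact h _ _ _
    · obtain rfl : j + 1 = i := hij
      rw [abs_sub_comm]
      exact h _ _ _

/-- If the `0`-layer of `f` is not constantly `0`, then the layers `1` and `-1` are constant with
a common value `ε = ±1`, and the `0`-layer takes values in `{0, 2ε}`. -/
theorem layers_of_mem_diff {n k : ℕ} (hn : 2 ≤ n) (hk : 0 < k) {f : ZMod n × Fin k → ℤ}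
    (hf : f ∈ Hnk n k hk \ H0nk n k hk) :
    ∃ ε : ℤ, (ε = 1 ∨ ε = -1) ∧ (∀ t, f (1, t) = ε) ∧ (∀ t, f (-1, t) = ε) ∧
      (∀ t, f (0, t) = 0 ∨ f (0, t) = 2 * ε) ∧ ∃ t, f (0, t) = 2 * ε := by
  obtain ⟨⟨hhom, h0⟩, hnot⟩ := hf
  obtain ⟨s, hs⟩ : ∃ s, f (0, s) ≠ 0 := by
    by_contra! hall
    exact hnot ⟨⟨hhom, h0⟩, hall⟩
  rw [isHomZ_Cnk_iff hn] at hhom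
  have hup : ∀ a t, |f (0, a) - f (1, t)| = 1 := fun a t => by simpa using hhom 0 a t
  have hlo : ∀ a t, |f (-1, t) - f (0, a)| = 1 := fun a t => by simpa using hhom (-1) t a
  refine ⟨f (1, ⟨0, hk⟩), ?_, ?_, ?_, ?_, s, ?_⟩
  · have := hup ⟨0, hk⟩ ⟨0, hk⟩
    grind
  · intro t
    have := hup ⟨0, hk⟩ ⟨0, hk⟩
    have := hup s ⟨0, hk⟩
    have := hup ⟨0, hk⟩ t
    have := hup s t
    grind
  · intro t
    have := hup ⟨0, hk⟩ ⟨0, hk⟩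
    have := hup s ⟨0, hk⟩
    have := hlo ⟨0, hk⟩ t
    have := hlo s t
    grind
  · intro t
    have := hup ⟨0, hk⟩ ⟨0, hk⟩
    have := hup t ⟨0, hk⟩
    grind
  · have := hup ⟨0, hk⟩ ⟨0, hk⟩
    have := hup s ⟨0, hk⟩
    grind

/-- The inverse of `f ↦ (f_↓, f(1,1), …)`: shift `g` by `ε` and insert a `0`-layer built
from `v`. -/
def fup (n k : ℕ) (g : ZMod (n - 2) × Fin k → ℤ) (ε : ℤ) (v : Fin (k - 1) → ℤ) :
    ZMod n × Fin k → ℤ :=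
  fun p =>
    if p.1 = 0 then
      if h : p.2.val = 0 then 0 else ε * v ⟨p.2.val - 1, by have := p.2.isLt; omega⟩
    else g (((p.1.val - 1 : ℕ) : ZMod (n - 2)), p.2) + ε

theorem fup_natCast_succ {n k : ℕ} (g : ZMod (n - 2) × Fin k → ℤ) (ε : ℤ)
    (v : Fin (k - 1) → ℤ) {j : ℕ} (hj : j + 1 < n) (s : Fin k) :
    fup n k g ε v (((j + 1 : ℕ) : ZMod n), s) = g ((j : ZMod (n - 2)), s) + ε := by
  have hval : ((j + 1 : ℕ) : ZMod n).val = j + 1 := ZMod.val_cast_of_lt hj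
  have hne : ((j + 1 : ℕ) : ZMod n) ≠ 0 := fun h => by rw [h] at hval; simp at hval
  simp only [fup, if_neg hne, hval, Nat.add_sub_cancel]

theorem fup_one {n k : ℕ} (hn : 2 ≤ n) (hk : 0 < k) {g : ZMod (n - 2) × Fin k → ℤ}
    (hg : g ∈ H0nk (n - 2) k hk) (ε : ℤ) (v : Fin (k - 1) → ℤ) (s : Fin k) :
    fup n k g ε v (1, s) = ε := by
  have h := fup_natCast_succ g ε v (j := 0) hn s
  simpa [hg.2] using h

theorem fup_zero_upIdx {n k : ℕ} (g : ZMod (n - 2) × Fin k → ℤ) (ε : ℤ)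
    (v : Fin (k - 1) → ℤ) (s : Fin (k - 1)) : fup n k g ε v (0, upIdx s) = ε * v s := by
  simp [fup, upIdx]

theorem fup_zero_zero {n k : ℕ} (hk : 0 < k) (g : ZMod (n - 2) × Fin k → ℤ) (ε : ℤ)
    (v : Fin (k - 1) → ℤ) : fup n k g ε v (0, ⟨0, hk⟩) = 0 := by
  simp [fup]

theorem eq_zero_or_eq_upIdx {k : ℕ} (hk : 0 < k) (s : Fin k) :
    s = ⟨0, hk⟩ ∨ ∃ t : Fin (k - 1), s = upIdx t := by
  obtain ⟨s, hs⟩ := s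
  rcases s with _ | s
  · exact Or.inl rfl
  · exact Or.inr ⟨⟨s, by omega⟩, rfl⟩

theorem fup_mem_diff {n k : ℕ} (hn : 4 ≤ n) (hk : 0 < k) {g : ZMod (n - 2) × Fin k → ℤ}
    (hg : g ∈ H0nk (n - 2) k hk) {ε : ℤ} (hε : ε = 1 ∨ ε = -1) {v : Fin (k - 1) → ℤ}
    (hv : ∀ s, v s = 0 ∨ v s = 2) (hv0 : v ≠ fun _ => 0) :
    fup n k g ε v ∈ Hnk n k hk \ H0nk n k hk := by
  have hzero : ∀ s, |fup n k g ε v (0, s) - ε| = 1 := by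
    intro s
    rcases eq_zero_or_eq_upIdx hk s with rfl | ⟨t, rfl⟩
    · rw [fup_zero_zero]
      rcases hε with rfl | rfl <;> rfl
    · rw [fup_zero_upIdx]
      rcases hε with rfl | rfl <;> rcases hv t with h | h <;> rw [h] <;> rfl
  have hghom := (isHomZ_Cnk_iff (by omega) g).1 hg.1.1
  refine ⟨⟨(isHomZ_Cnk_iff (by omega) _).2 ?_, fup_zero_zero hk g ε v⟩, ?_⟩
  · intro i s t
    have : NeZero n := ⟨by omega⟩
    obtain ⟨j, hj, rfl⟩ : ∃ j < n, (j : ZMod n) = i := ⟨i.val, i.val_lt, ZMod.natCast_zmod_val i⟩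
    rcases j with _ | j
    · rw [Nat.cast_zero, zero_add, fup_one (by omega) hk hg]
      exact hzero s
    · rw [fup_natCast_succ g ε v hj]
      by_cases hlast : j + 2 = n
      · have h0 : ((j + 1 : ℕ) : ZMod n) + 1 = 0 := by
          rw [natCast_eq_neg_one hlast, neg_add_cancel]
        have hj0 : (j : ZMod (n - 2)) = 0 := by
          rw [show j = n - 2 by omega, ZMod.natCast_self]
        rw [h0, hj0, hg.2, zero_add, abs_sub_comm]
        exact hzero t
      · have h1 : ((j + 1 : ℕ) : ZMod n) + 1 = ((j + 1 + 1 : ℕ) : ZMod n) := by push_cast; ring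
        rw [h1, fup_natCast_succ g ε v (by omega), add_sub_add_right_eq_sub, Nat.cast_succ]
        exact hghom _ _ _
  · rintro ⟨-, h⟩
    refine hv0 (funext fun s => ?_)
    have hs := h (upIdx s)
    rw [fup_zero_upIdx] at hs
    rcases hε with rfl | rfl <;> linarith

theorem fdown_fup {n k : ℕ} (hn : 4 ≤ n) (hk : 0 < k) {g : ZMod (n - 2) × Fin k → ℤ}
    (hg : g ∈ H0nk (n - 2) k hk) (ε : ℤ) (v : Fin (k - 1) → ℤ) :
    fdown n k hk (fup n k g ε v) = g := by
  have : NeZero (n - 2) := ⟨by omega⟩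
  funext ⟨i, s⟩
  have hi := i.val_lt
  simp only [fdown]
  rw [fup_natCast_succ g ε v (by omega), fup_one (by omega) hk hg, ZMod.natCast_zmod_val]
  ring

theorem fdown_mem {n k : ℕ} (hn : 4 ≤ n) (hk : 0 < k) {f : ZMod n × Fin k → ℤ}
    (hf : f ∈ Hnk n k hk \ H0nk n k hk) : fdown n k hk f ∈ H0nk (n - 2) k hk := by
  obtain ⟨ε, -, h1, hm1, -⟩ := layers_of_mem_diff (by omega) hk hf
  have hhom := (isHomZ_Cnk_iff (by omega) f).1 hf.1.1
  have hz : ∀ s, fdown n k hk f (0, s) = 0 := fun s => by simp [fdown, h1]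
  refine ⟨⟨(isHomZ_Cnk_iff (by omega) _).2 ?_, hz _⟩, hz⟩
  intro i s t
  have : NeZero (n - 2) := ⟨by omega⟩
  have hi := i.val_lt
  have hstep : |f (((i.val + 1 : ℕ) : ZMod n), s) - f (((i.val + 1 : ℕ) : ZMod n) + 1, t)| = 1 :=
    hhom _ _ _
  by_cases hlast : i.val + 1 = n - 2
  · have hi0 : i + 1 = 0 := by
      rw [← ZMod.natCast_zmod_val i, ← Nat.cast_succ, Nat.succ_eq_add_one, hlast, ZMod.natCast_self]
    have hcast : ((i.val + 1 : ℕ) : ZMod n) + 1 = -1 := by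
      rw [← Nat.cast_succ]
      exact natCast_eq_neg_one (by omega)
    rw [hcast, hm1] at hstep
    rw [hi0, hz]
    simpa [fdown, h1] using hstep
  · have hval : (i + 1).val = i.val + 1 := by
      have : Fact (1 < n - 2) := ⟨by omega⟩
      rw [ZMod.val_add_of_lt, ZMod.val_one]
      rw [ZMod.val_one]
      omega
    simp only [fdown, hval, sub_sub_sub_cancel_right]
    rwa [Nat.cast_succ (i.val + 1)]

theorem eq_of_fdown_eq {n k : ℕ} (hn : 4 ≤ n) (hk : 0 < k) {f f' : ZMod n × Fin k → ℤ}
    (hf : f ∈ Hnk n k hk \ H0nk n k hk) (hf' : f' ∈ Hnk n k hk \ H0nk n k hk)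
    (hdown : fdown n k hk f = fdown n k hk f') (hone : f (1, ⟨0, hk⟩) = f' (1, ⟨0, hk⟩))
    (hzero : ∀ s : Fin (k - 1), f (0, upIdx s) = f' (0, upIdx s)) : f = f' := by
  obtain ⟨ε, -, h1, hm1, -⟩ := layers_of_mem_diff (by omega) hk hf
  obtain ⟨ε', -, h1', hm1', -⟩ := layers_of_mem_diff (by omega) hk hf'
  obtain rfl : ε = ε' := by rw [← h1 ⟨0, hk⟩, hone, h1']
  have : NeZero n := ⟨by omega⟩
  funext ⟨i, s⟩
  obtain ⟨j, hj, rfl⟩ : ∃ j < n, (j : ZMod n) = i := ⟨i.val, i.val_lt, ZMod.natCast_zmod_val i⟩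
  rcases j with _ | j
  · rw [Nat.cast_zero]
    rcases eq_zero_or_eq_upIdx hk s with rfl | ⟨t, rfl⟩
    · rw [hf.1.2, hf'.1.2]
    · exact hzero t
  · by_cases hlast : j + 2 = n
    · have hcast : ((j + 1 : ℕ) : ZMod n) = -1 :=
        natCast_eq_neg_one hlast
      rw [hcast, hm1, hm1']
    · have h := congrFun hdown ((j : ZMod (n - 2)), s)
      simp only [fdown, ZMod.val_cast_of_lt (show j < n - 2 by omega), h1, h1'] at h
      linarith

theorem bijOn_fdown {n k : ℕ} (hn : 4 ≤ n) (hk : 0 < k) :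
    Set.BijOn
      (fun f : ZMod n × Fin k → ℤ =>
        (fdown n k hk f, f ((1 : ZMod n), ⟨0, hk⟩),
          fun s : Fin (k - 1) => f ((1 : ZMod n), ⟨0, hk⟩) * f ((0 : ZMod n), upIdx s)))
      (Hnk n k hk \ H0nk n k hk)
      ((H0nk (n - 2) k hk) ×ˢ (({1, -1} : Set ℤ) ×ˢ
        {v : Fin (k - 1) → ℤ | (∀ s, v s = 0 ∨ v s = 2) ∧ v ≠ fun _ => 0})) := by
  refine ⟨fun f hf => ?_, fun f hf f' hf' heq => ?_, ?_⟩
  · obtain ⟨ε, hε, h1, -, h0, s, hs⟩ := layers_of_mem_diff (by omega) hk hf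
    refine ⟨fdown_mem hn hk hf, by simpa [h1] using hε, fun t => ?_, fun hv => ?_⟩
    · simp only [h1]
      rcases hε with rfl | rfl <;> rcases h0 (upIdx t) with h | h <;> simp [h]
    · rcases eq_zero_or_eq_upIdx hk s with rfl | ⟨t, rfl⟩
      · rw [hf.1.2] at hs
        omega
      · have := congrFun hv t
        simp only [h1, hs] at this
        rcases hε with rfl | rfl <;> norm_num at this
  · simp only [Prod.mk.injEq] at heq
    obtain ⟨hdown, hone, hzero⟩ := heq
    refine eq_of_fdown_eq hn hk hf hf' hdown hone fun s => ?_
    have hs := congrFun hzero s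
    obtain ⟨ε, hε, h1, -⟩ := layers_of_mem_diff (by omega) hk hf
    rw [← hone, h1] at hs
    rcases hε with rfl | rfl <;> linarith
  · rintro ⟨g, ε, v⟩ ⟨hg, hε, hv, hv0⟩
    have hε' : ε = 1 ∨ ε = -1 := by simpa using hε
    refine ⟨fup n k g ε v, fup_mem_diff hn hk hg hε' hv hv0, ?_⟩
    simp only [fdown_fup hn hk hg, fup_one (show 2 ≤ n by omega) hk hg, fup_zero_upIdx,
      Prod.mk.injEq, true_and]
    funext s
    rcases hε' with rfl | rfl <;> ring

/-- If a set is in bijection with a product, the fibres of the first coordinate are equinumerous. -/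
theorem Set.BijOn.ncard_fiber_mul {α β γ : Type*} {φ : α → β} {ψ : α → γ} {S : Set α} {A : Set β}
    {B : Set γ} (h : Set.BijOn (fun x => (φ x, ψ x)) S (A ×ˢ B)) {b : β} (hb : b ∈ A) :
    {x ∈ S | φ x = b}.ncard * A.ncard = S.ncard := by
  have hfib : Set.BijOn ψ {x ∈ S | φ x = b} B := by
    refine ⟨fun x hx => (h.mapsTo hx.1).2, fun x hx y hy hxy => ?_, fun c hc => ?_⟩
    · exact h.injOn hx.1 hy.1 (Prod.ext (hx.2.trans hy.2.symm) hxy)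
    · obtain ⟨x, hx, hxe⟩ := h.surjOn (Set.mk_mem_prod hb hc)
      obtain ⟨hx1, hx2⟩ := Prod.mk.inj hxe
      exact ⟨x, ⟨hx, hx1⟩, hx2⟩
  rw [hfib.ncard_eq, h.ncard_eq, Set.ncard_prod, mul_comm]

theorem stmt9 (n k : ℕ) (hn : 4 ≤ n) (hne : Even n) (hk : 0 < k) :
    Set.BijOn
      (fun f : ZMod n × Fin k → ℤ =>
        (fdown n k hk f, f ((1 : ZMod n), ⟨0, hk⟩),
          fun s : Fin (k - 1) => f ((1 : ZMod n), ⟨0, hk⟩) * f ((0 : ZMod n), upIdx s)))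
      (Hnk n k hk \ H0nk n k hk)
      ((H0nk (n - 2) k hk) ×ˢ (({1, -1} : Set ℤ) ×ˢ
        {v : Fin (k - 1) → ℤ | (∀ s, v s = 0 ∨ v s = 2) ∧ v ≠ fun _ => 0})) ∧
    -- consequently, `f_↓` is uniformly distributed in `H⁰_{n-2,k}` when `f`
    -- is uniform in `H_{n,k} \ H⁰_{n,k}`
    ∀ g ∈ H0nk (n - 2) k hk,
      ({f ∈ Hnk n k hk \ H0nk n k hk | fdown n k hk f = g}).ncard
          * (H0nk (n - 2) k hk).ncard
        = (Hnk n k hk \ H0nk n k hk).ncard := by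
  exact ⟨bijOn_fdown hn hk, fun g hg => (bijOn_fdown hn hk).ncard_fiber_mul hg⟩
end

section
/- Let n ∈ ℕ be even and let k = k(n) ∈ ℕ satisfy k(n) ≥ 2·log₂ n + ψ(n), where ψ: ℕ → ℝ⁺ satisfies lim_{n→∞} ψ(n) = ∞. Let f_n be chosen uniformly at random from H⁰_{n,k}. Then Pr[|NC(f_n)| = n/2] = 1 − o(1) as n → ∞. -/
open Filter

/-- The non-constant `0`-`1` patterns on `k` points. -/
abbrev MixedPattern (k : ℕ) : Type := {e : Fin k → Bool // ∃ s t, e s ≠ e t}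

lemma two_pow_le_card_mixedPattern (k : ℕ) :
    2 ^ k ≤ Fintype.card (MixedPattern k) + 2 := by
  classical
  have h1 := Fintype.card_subtype_compl (fun e : Fin k → Bool => ∃ s t, e s ≠ e t)
  have h2 : Fintype.card {e : Fin k → Bool // ¬ ∃ s t, e s ≠ e t} ≤ 2 := by
    rcases Nat.eq_zero_or_pos k with rfl | hk
    · exact (Fintype.card_subtype_le _).trans (by simp)
    · have hinj : Function.Injective
          (fun e : {e : Fin k → Bool // ¬ ∃ s t, e s ≠ e t} => e.1 ⟨0, hk⟩) := by
        rintro ⟨e, he⟩ ⟨e', he'⟩ h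
        push Not at he he'
        ext s
        simp only at h
        simp only [he s ⟨0, hk⟩, he' s ⟨0, hk⟩, h]
      simpa using Fintype.card_le_of_injective _ hinj
  have h3 : Fintype.card (Fin k → Bool) = 2 ^ k := by simp
  have h4 : Fintype.card (MixedPattern k) ≤ Fintype.card (Fin k → Bool) :=
    Fintype.card_subtype_le _
  unfold MixedPattern at *
  omega

/-- The sign `±1` encoded by a Boolean. -/
def boolSign (b : Bool) : ℤ := if b then 1 else -1

lemma abs_boolSign (b : Bool) : |boolSign b| = 1 := by cases b <;> rfl

lemma boolSign_injective : Function.Injective boolSign := by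
  intro a b; cases a <;> cases b <;> simp [boolSign]

/-- Layered height functions along a path: they start at the constant layer `0`, change by exactly
`1` between any vertices of the first `N + 1` consecutive layers, have a constant `N`-layer, and
are extended by zero beyond it. -/
def layeredPaths (k N : ℕ) : Set (ℕ → Fin k → ℤ) :=
  {g | g 0 = 0 ∧ (∀ i < N, ∀ s t, |g i s - g (i + 1) t| = 1) ∧
    (∀ s t, g N s = g N t) ∧ ∀ i, N < i → g i = 0}

/-- Append a constant layer, one step up or down. -/
def appendStep {k : ℕ} (N : ℕ) (x : Bool × (ℕ → Fin k → ℤ)) : ℕ → Fin k → ℤ :=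
  Function.update x.2 (N + 1) fun s => x.2 N s + boolSign x.1

/-- Append a non-constant layer and return to the previous height. -/
def appendMixed {k : ℕ} (N : ℕ) (x : MixedPattern k × (ℕ → Fin k → ℤ)) : ℕ → Fin k → ℤ :=
  Function.update (Function.update x.2 (N + 1) fun s => x.2 N s + boolSign (x.1.1 s))
    (N + 2) (x.2 N)

lemma exists_boolSign_add {a b : ℤ} (h : |a - b| = 1) : ∃ c, b = a + boolSign c := by
  rcases (abs_eq zero_le_one).1 h with h | h
  · exact ⟨false, by simp [boolSign]; omega⟩
  · exact ⟨true, by simp [boolSign]; omega⟩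

lemma layeredPaths_zero (k : ℕ) : layeredPaths k 0 ⊆ {0} := by
  rintro g ⟨h0, -, -, h⟩
  ext i s
  rcases Nat.eq_zero_or_pos i with rfl | hi
  · rw [h0]; rfl
  · rw [h i hi]; rfl

/-- Replace all layers beyond the `N`-layer by zero. -/
def truncate {k : ℕ} (N : ℕ) (g : ℕ → Fin k → ℤ) : ℕ → Fin k → ℤ :=
  fun i => if i ≤ N then g i else 0

lemma truncate_mem_layeredPaths {k N M : ℕ} (hNM : N ≤ M) {g : ℕ → Fin k → ℤ}
    (hg : g ∈ layeredPaths k M) (hc : ∀ s t, g N s = g N t) :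
    truncate N g ∈ layeredPaths k N := by
  refine ⟨by simpa [truncate] using hg.1, fun i hi s t => ?_, by simpa [truncate] using hc, fun i hi => ?_⟩
  · simpa [truncate, hi.le, Nat.succ_le_of_lt hi] using hg.2.1 i (by omega) s t
  · simp [truncate, hi]

lemma mem_image_appendStep {k N : ℕ} (hk : 0 < k) {g : ℕ → Fin k → ℤ}
    (hg : g ∈ layeredPaths k (N + 1)) (hc : ∀ s t, g N s = g N t) :
    g ∈ appendStep N '' (Set.univ ×ˢ layeredPaths k N) := by
  obtain ⟨c, h⟩ := exists_boolSign_add (hg.2.1 N (by omega) ⟨0, hk⟩ ⟨0, hk⟩)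
  refine ⟨(c, truncate N g), ⟨trivial, truncate_mem_layeredPaths (by omega) hg hc⟩, ?_⟩
  ext i s
  rcases lt_trichotomy i (N + 1) with hi | rfl | hi
  · simp [appendStep, truncate, hi.ne, Nat.le_of_lt_succ hi]
  · simp [appendStep, truncate, hg.2.2.1 s ⟨0, hk⟩, hc s ⟨0, hk⟩, h]
  · simp [appendStep, truncate, hi.ne', show ¬ i ≤ N by omega, hg.2.2.2 i hi]

lemma mem_image_appendMixed {k N : ℕ} {g : ℕ → Fin k → ℤ}
    (hg : g ∈ layeredPaths k (N + 2)) (hc : ¬ ∀ s t, g (N + 1) s = g (N + 1) t) :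
    g ∈ appendMixed N '' (Set.univ ×ˢ layeredPaths k N) := by
  push Not at hc
  obtain ⟨s₀, t₀, hst⟩ := hc
  have key : ∀ a b : ℤ, |a - g (N + 1) s₀| = 1 → |a - g (N + 1) t₀| = 1 →
      |b - g (N + 1) s₀| = 1 → |b - g (N + 1) t₀| = 1 → a = b := by
    intro a b h1 h2 h3 h4
    rw [abs_eq zero_le_one] at h1 h2 h3 h4
    omega
  have hl := hg.2.1 N (by omega)
  have hr : ∀ t s, |g (N + 2) s - g (N + 1) t| = 1 := fun t s => by
    rw [abs_sub_comm]; exact hg.2.1 (N + 1) (by omega) t s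
  have hcN : ∀ s t, g N s = g N t := fun s t => key _ _ (hl s s₀) (hl s t₀) (hl t s₀) (hl t t₀)
  have hback : ∀ s, g (N + 2) s = g N s := fun s =>
    key _ _ (hr s₀ s) (hr t₀ s) (hl s s₀) (hl s t₀)
  choose e he using fun s => exists_boolSign_add (hl s s)
  have hmix : e s₀ ≠ e t₀ := fun h => hst (by rw [he s₀, he t₀, h, hcN s₀ t₀])
  refine ⟨(⟨e, s₀, t₀, hmix⟩, truncate N g),
    ⟨trivial, truncate_mem_layeredPaths (by omega) hg hcN⟩, ?_⟩
  ext i s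
  by_cases h2 : i = N + 2
  · subst h2; simp [appendMixed, truncate, hback]
  by_cases h1 : i = N + 1
  · subst h1; simp [appendMixed, truncate, he]
  by_cases h0 : i ≤ N
  · simp [appendMixed, truncate, h1, h2, h0]
  · simp [appendMixed, truncate, h1, h2, h0, hg.2.2.2 i (by omega)]

lemma layeredPaths_one {k : ℕ} (hk : 0 < k) :
    layeredPaths k 1 ⊆ appendStep 0 '' (Set.univ ×ˢ layeredPaths k 0) := fun g hg =>
  mem_image_appendStep hk hg (by simp [hg.1])

lemma layeredPaths_add_two {k : ℕ} (hk : 0 < k) (N : ℕ) :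
    layeredPaths k (N + 2) ⊆ appendStep (N + 1) '' (Set.univ ×ˢ layeredPaths k (N + 1)) ∪
      appendMixed N '' (Set.univ ×ˢ layeredPaths k N) := by
  intro g hg
  by_cases hc : ∀ s t, g (N + 1) s = g (N + 1) t
  · exact Or.inl (mem_image_appendStep hk hg hc)
  · exact Or.inr (mem_image_appendMixed hg hc)

lemma layeredPaths_finite {k : ℕ} (hk : 0 < k) (N : ℕ) : (layeredPaths k N).Finite := by
  induction N using Nat.twoStepInduction with
  | zero => exact (Set.finite_singleton _).subset (layeredPaths_zero k)
  | one =>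
    exact ((Set.finite_univ.prod ((Set.finite_singleton _).subset (layeredPaths_zero k))).image
      _).subset (layeredPaths_one hk)
  | more N h0 h1 =>
    exact (((Set.finite_univ.prod h1).image _).union ((Set.finite_univ.prod h0).image _)).subset
      (layeredPaths_add_two hk N)

lemma ncard_image_univ_prod_le {α β γ : Type*} [Fintype α] (F : α × β → γ) {P : Set β}
    (hP : P.Finite) : (F '' (Set.univ ×ˢ P)).ncard ≤ Fintype.card α * P.ncard := by
  refine (Set.ncard_image_le (Set.finite_univ.prod hP)).trans ?_
  rw [Set.ncard_prod, Set.ncard_univ, Nat.card_eq_fintype_card]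

lemma ncard_layeredPaths_le {k : ℕ} (hk : 0 < k) (N : ℕ) :
    ((layeredPaths k N).ncard : ℝ) ≤ (√(Fintype.card (MixedPattern k)) + 2) ^ N := by
  have hsq := Real.sq_sqrt (Nat.cast_nonneg (α := ℝ) (Fintype.card (MixedPattern k)))
  set q := Fintype.card (MixedPattern k)
  have hr := Real.sqrt_nonneg (q : ℝ)
  have hfin := layeredPaths_finite hk
  have h0 : (layeredPaths k 0).ncard ≤ 1 := by
    simpa using Set.ncard_le_ncard (layeredPaths_zero k)
  induction N using Nat.twoStepInduction with
  | zero => simpa using h0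
  | one =>
    have h : (layeredPaths k 1).ncard ≤ 2 := by
      have h1 := Set.ncard_le_ncard (layeredPaths_one hk)
        ((Set.finite_univ.prod (hfin 0)).image _)
      have h2 := ncard_image_univ_prod_le (appendStep (k := k) 0) (hfin 0)
      rw [Fintype.card_bool] at h2
      omega
    have h' : ((layeredPaths k 1).ncard : ℝ) ≤ 2 := by exact_mod_cast h
    rw [pow_one]
    linarith
  | more N ih0 ih1 =>
    have h1 := Set.ncard_le_ncard (layeredPaths_add_two hk N)
      (((Set.finite_univ.prod (hfin (N + 1))).image _).union
        ((Set.finite_univ.prod (hfin N)).image _))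
    have h2 := ncard_image_univ_prod_le (appendStep (k := k) (N + 1)) (hfin (N + 1))
    have h3 := ncard_image_univ_prod_le (appendMixed (k := k) N) (hfin N)
    rw [Fintype.card_bool] at h2
    have h4 : ((layeredPaths k (N + 2)).ncard : ℝ) ≤
        2 * (layeredPaths k (N + 1)).ncard + q * (layeredPaths k N).ncard := by
      exact_mod_cast h1.trans ((Set.ncard_union_le _ _).trans (add_le_add h2 h3))
    calc ((layeredPaths k (N + 2)).ncard : ℝ)
        ≤ 2 * (√q + 2) ^ (N + 1) + q * (√q + 2) ^ N := by
          refine h4.trans ?_; gcongr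
      _ = (2 * (√q + 2) + √q ^ 2) * (√q + 2) ^ N := by rw [hsq]; ring
      _ ≤ (√q + 2) ^ 2 * (√q + 2) ^ N := by gcongr; nlinarith
      _ = (√q + 2) ^ (N + 2) := by ring

/-- Cut the cycle open at the `0`-layer. -/
def unroll {n k : ℕ} (f : ZMod n × Fin k → ℤ) : ℕ → Fin k → ℤ :=
  fun i s => if i ≤ n then f (i, s) else 0

lemma unroll_injective {n k : ℕ} (hn : 0 < n) :
    Function.Injective (unroll : (ZMod n × Fin k → ℤ) → _) := by
  have : NeZero n := ⟨hn.ne'⟩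
  intro f g h
  ext ⟨i, s⟩
  simpa [unroll, (ZMod.val_lt i).le] using congrFun (congrFun h i.val) s

lemma unroll_mem_layeredPaths {n k : ℕ} (hn : 2 ≤ n) (hk : 0 < k) {f : ZMod n × Fin k → ℤ}
    (hf : f ∈ H0nk n k hk) : unroll f ∈ layeredPaths k n := by
  have : Fact (1 < n) := ⟨hn⟩
  refine ⟨?_, fun i hi s t => ?_, fun s t => ?_, fun i hi => ?_⟩
  · ext s; simp [unroll, hf.2 s]
  · have h := hf.1.1 ((i : ZMod n), s) (((i + 1 : ℕ) : ZMod n), t)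
      (by simp [Cnk])
    simpa [unroll, hi.le, Nat.succ_le_of_lt hi] using h
  · simp [unroll, hf.2]
  · ext s; simp [unroll, hi]

lemma H0nk_finite {n k : ℕ} (hn : 2 ≤ n) (hk : 0 < k) : (H0nk n k hk).Finite :=
  Set.Finite.of_injOn (fun _ hf => unroll_mem_layeredPaths hn hk hf)
    (unroll_injective (by omega)).injOn (layeredPaths_finite hk n)

lemma ncard_H0nk_le {n k : ℕ} (hn : 2 ≤ n) (hk : 0 < k) :
    ((H0nk n k hk).ncard : ℝ) ≤ (√(Fintype.card (MixedPattern k)) + 2) ^ n := by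
  refine le_trans ?_ (ncard_layeredPaths_le hk n)
  exact_mod_cast Set.ncard_le_ncard_of_injOn unroll
    (fun _ hf => unroll_mem_layeredPaths hn hk hf)
    (unroll_injective (by omega)).injOn (layeredPaths_finite hk n)

/-- The homomorphism that vanishes on even layers and has prescribed mixed patterns on the odd
layers of a cycle of length `2 * m`. -/
def zigzag {m k : ℕ} (e : Fin m → MixedPattern k) (x : ZMod (2 * m) × Fin k) : ℤ :=
  if h : x.1.val / 2 < m ∧ x.1.val % 2 = 1 then boolSign ((e ⟨x.1.val / 2, h.1⟩).1 x.2) else 0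

lemma val_div_two_lt {m : ℕ} (hm : 0 < m) (i : ZMod (2 * m)) : i.val / 2 < m := by
  have : NeZero (2 * m) := ⟨by omega⟩
  have := ZMod.val_lt i
  omega

lemma zigzag_even {m k : ℕ} (e : Fin m → MixedPattern k) {i : ZMod (2 * m)}
    (hi : i.val % 2 = 0) (s : Fin k) : zigzag e (i, s) = 0 := by
  simp [zigzag, hi]

lemma abs_zigzag_odd {m k : ℕ} (hm : 0 < m) (e : Fin m → MixedPattern k) {i : ZMod (2 * m)}
    (hi : i.val % 2 = 1) (s : Fin k) : |zigzag e (i, s)| = 1 := by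
  simp [zigzag, hi, val_div_two_lt hm, abs_boolSign]

lemma val_oddLayer {m : ℕ} (j : Fin m) :
    ((2 * j.val + 1 : ℕ) : ZMod (2 * m)).val = 2 * j.val + 1 :=
  ZMod.val_cast_of_lt (by omega)

lemma zigzag_oddLayer {m k : ℕ} (e : Fin m → MixedPattern k) (j : Fin m) (s : Fin k) :
    zigzag e (((2 * j.val + 1 : ℕ) : ZMod (2 * m)), s) = boolSign ((e j).1 s) := by
  have h1 : (2 * j.val + 1) / 2 = j.val := by omega
  have h2 : (2 * j.val + 1) % 2 = 1 := by omega
  simp only [zigzag, val_oddLayer, h1, h2, j.2, Fin.eta, and_self, dite_true]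

lemma zigzag_injective {m k : ℕ} :
    Function.Injective (zigzag : (Fin m → MixedPattern k) → _) := by
  intro e e' h
  ext j s
  have h := congrFun h (((2 * j.val + 1 : ℕ) : ZMod (2 * m)), s)
  rw [zigzag_oddLayer, zigzag_oddLayer] at h
  rw [boolSign_injective h]

lemma val_add_one_mod_two {m : ℕ} (hm : 0 < m) (i : ZMod (2 * m)) :
    (i + 1).val % 2 = (i.val + 1) % 2 := by
  have : Fact (1 < 2 * m) := ⟨by omega⟩
  rw [ZMod.val_add, ZMod.val_one, Nat.mod_mul_right_mod]

lemma abs_zigzag_sub {m k : ℕ} (hm : 0 < m) (e : Fin m → MixedPattern k) (i : ZMod (2 * m))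
    (s t : Fin k) : |zigzag e (i, s) - zigzag e (i + 1, t)| = 1 := by
  have h := val_add_one_mod_two hm i
  rcases Nat.mod_two_eq_zero_or_one i.val with hi | hi
  · rw [zigzag_even e hi, zero_sub, abs_neg]
    exact abs_zigzag_odd hm e (by omega) t
  · rw [zigzag_even e (i := i + 1) (by omega), sub_zero]
    exact abs_zigzag_odd hm e hi s

lemma zigzag_mem_H0nk {m k : ℕ} (hm : 0 < m) (hk : 0 < k) (e : Fin m → MixedPattern k) :
    zigzag e ∈ H0nk (2 * m) k hk := by
  have h0 : ∀ s, zigzag e (0, s) = 0 := fun s => zigzag_even e (by simp) s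
  refine ⟨⟨?_, h0 _⟩, h0⟩
  rintro ⟨i, s⟩ ⟨j, t⟩ hadj
  obtain ⟨-, rfl | rfl⟩ : _ ∧ (i + 1 = j ∨ j + 1 = i) := by
    simpa only [Cnk, SimpleGraph.fromRel_adj] using hadj
  · exact abs_zigzag_sub hm e i s t
  · rw [abs_sub_comm]; exact abs_zigzag_sub hm e j t s

lemma NCset_zigzag {m k : ℕ} (hm : 0 < m) (e : Fin m → MixedPattern k) :
    NCset (zigzag e) = Set.range fun j : Fin m => ((2 * j.val + 1 : ℕ) : ZMod (2 * m)) := by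
  have : NeZero (2 * m) := ⟨by omega⟩
  ext i
  constructor
  · intro hi
    rcases Nat.mod_two_eq_zero_or_one i.val with h | h
    · exact absurd (fun s t => by rw [zigzag_even e h, zigzag_even e h]) hi
    · refine ⟨⟨i.val / 2, val_div_two_lt hm i⟩, ?_⟩
      simp only [show 2 * (i.val / 2) + 1 = i.val by omega, ZMod.natCast_zmod_val]
  · rintro ⟨j, rfl⟩ hc
    obtain ⟨s, t, hst⟩ := (e j).2
    have := hc s t
    rw [zigzag_oddLayer, zigzag_oddLayer] at this
    exact hst (boolSign_injective this)

lemma ncard_NCset_zigzag {m k : ℕ} (hm : 0 < m) (e : Fin m → MixedPattern k) :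
    (NCset (zigzag e)).ncard = m := by
  rw [NCset_zigzag hm, ← Set.image_univ, Set.ncard_image_of_injective, Set.ncard_univ,
    Nat.card_eq_fintype_card, Fintype.card_fin]
  intro i j h
  have := congrArg ZMod.val h
  simp only [val_oddLayer] at this
  ext
  omega

lemma card_mixedPattern_pow_le {m k : ℕ} (hm : 0 < m) (hk : 0 < k) :
    Fintype.card (MixedPattern k) ^ m ≤
      ({f ∈ H0nk (2 * m) k hk | (NCset f).ncard = m}).ncard := by
  have h := Set.ncard_le_ncard_of_injOn (s := Set.univ)
    (t := {f ∈ H0nk (2 * m) k hk | (NCset f).ncard = m}) (zigzag : (Fin m → MixedPattern k) → _)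
    (fun e _ => ⟨zigzag_mem_H0nk hm hk e, ncard_NCset_zigzag hm e⟩)
    zigzag_injective.injOn ((H0nk_finite (by omega) hk).subset (Set.sep_subset _ _))
  simpa [Set.ncard_univ] using h

lemma one_sub_le_ratio {n k : ℕ} (hn : 2 ≤ n) (hne : Even n) (hk : 0 < k)
    (hq : 4 ≤ Fintype.card (MixedPattern k)) :
    1 - 2 * n / √(Fintype.card (MixedPattern k)) ≤
      (({f ∈ H0nk n k hk | (NCset f).ncard = n / 2}).ncard : ℝ) / ((H0nk n k hk).ncard : ℝ) := by
  obtain ⟨m, rfl⟩ := hne.exists_two_nsmul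
  rw [smul_eq_mul] at *
  have htot := ncard_H0nk_le hn hk
  have hgood := card_mixedPattern_pow_le (m := m) (by omega) hk
  have hle := Set.ncard_le_ncard (Set.sep_subset (H0nk (2 * m) k hk)
    fun f => (NCset f).ncard = m) (H0nk_finite hn hk)
  rw [Nat.mul_div_cancel_left m two_pos]
  set q := Fintype.card (MixedPattern k)
  have hsq : √(q : ℝ) ^ 2 = q := Real.sq_sqrt (Nat.cast_nonneg _)
  have hq2 : 2 ≤ √(q : ℝ) := Real.le_sqrt_of_sq_le (by norm_num; exact_mod_cast hq)
  have hr : 0 < √(q : ℝ) := by linarith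
  have hgood' : √(q : ℝ) ^ (2 * m) ≤
      ({f ∈ H0nk (2 * m) k hk | (NCset f).ncard = m}).ncard := by
    rw [pow_mul, hsq]; exact_mod_cast hgood
  have hpos : 0 < ((H0nk (2 * m) k hk).ncard : ℝ) := by
    have : 0 < √(q : ℝ) ^ (2 * m) := by positivity
    exact this.trans_le (hgood'.trans (by exact_mod_cast hle))
  have hstep : 1 - 2 / √(q : ℝ) ≤ √q / (√q + 2) := by
    rw [le_div_iff₀ (by positivity)]
    have : (1 - 2 / √(q : ℝ)) * (√q + 2) = √q - 4 / √q := by field_simp; ring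
    rw [this]
    have : 0 < 4 / √(q : ℝ) := by positivity
    linarith
  have hbase : 0 ≤ 1 - 2 / √(q : ℝ) := by
    rw [sub_nonneg, div_le_one hr]; exact hq2
  calc 1 - 2 * ((2 * m : ℕ) : ℝ) / √q = 1 + ((2 * m : ℕ) : ℝ) * (-(2 / √q)) := by ring
    _ ≤ (1 + -(2 / √(q : ℝ))) ^ (2 * m) := one_add_mul_le_pow (by linarith) _
    _ = (1 - 2 / √(q : ℝ)) ^ (2 * m) := by rw [← sub_eq_add_neg]
    _ ≤ (√q / (√q + 2)) ^ (2 * m) := by gcongr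
    _ = √(q : ℝ) ^ (2 * m) / (√q + 2) ^ (2 * m) := div_pow _ _ _
    _ ≤ _ := by gcongr

lemma two_mul_div_sqrt_card_le {n k : ℕ} {p : ℝ} (hn : 0 < n) (hk : 2 ≤ k)
    (h : 2 * Real.logb 2 n + p ≤ k) :
    2 * n / √(Fintype.card (MixedPattern k)) ≤ 2 * (2 : ℝ) ^ (-((p - 1) / 2)) := by
  have hcard : (2 : ℝ) ^ k ≤ Fintype.card (MixedPattern k) + 2 := by
    exact_mod_cast two_pow_le_card_mixedPattern k
  set q := Fintype.card (MixedPattern k)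
  have hn' : (0 : ℝ) < n := by exact_mod_cast hn
  have h4 : (4 : ℝ) ≤ 2 ^ k := by
    have := pow_le_pow_right₀ (one_le_two (α := ℝ)) hk
    linarith
  have hlog : (2 : ℝ) ^ (2 * Real.logb 2 n) = n ^ 2 := by
    rw [mul_comm, Real.rpow_mul two_pos.le, Real.rpow_logb two_pos (by norm_num) hn',
      Real.rpow_two]
  have hhalf : ((2 : ℝ) ^ ((p - 1) / 2)) ^ 2 = 2 ^ (p - 1) := by
    rw [← Real.rpow_mul_natCast two_pos.le, Nat.cast_two, div_mul_cancel₀ _ two_ne_zero]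
  have hk' : (n * (2 : ℝ) ^ ((p - 1) / 2)) ^ 2 ≤ 2 ^ k / 2 := by
    calc (n * (2 : ℝ) ^ ((p - 1) / 2)) ^ 2
        = (2 : ℝ) ^ (2 * Real.logb 2 n + p) / 2 := by
          rw [mul_pow, hhalf, Real.rpow_add two_pos, hlog, Real.rpow_sub_one two_ne_zero]
          ring
      _ ≤ (2 : ℝ) ^ (k : ℝ) / 2 := by gcongr; norm_num
      _ = 2 ^ k / 2 := by rw [Real.rpow_natCast]
  have hsqrt : n * (2 : ℝ) ^ ((p - 1) / 2) ≤ √q := Real.le_sqrt_of_sq_le (by linarith)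
  have hpos : 0 < n * (2 : ℝ) ^ ((p - 1) / 2) := by positivity
  calc 2 * n / √(q : ℝ) ≤ 2 * n / (n * (2 : ℝ) ^ ((p - 1) / 2)) := by gcongr
    _ = 2 * (2 : ℝ) ^ (-((p - 1) / 2)) := by
      rw [Real.rpow_neg two_pos.le]; field_simp

theorem stmt14 (k : ℕ → ℕ) (hk : ∀ n, 0 < k n) (ψ : ℕ → ℝ)
    (hψpos : ∀ n, 0 < ψ n) (hψ : Tendsto ψ atTop atTop)
    (hkn : ∀ n : ℕ, Even n → 2 * Real.logb 2 n + ψ n ≤ (k n : ℝ)) :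
    Tendsto (fun n =>
      (({f ∈ H0nk n (k n) (hk n) | (NCset f).ncard = n / 2}).ncard : ℝ)
        / ((H0nk n (k n) (hk n)).ncard : ℝ))
      (atTop ⊓ Filter.principal {n : ℕ | Even n}) (nhds 1) := by
  have hlim : Tendsto (fun n => 1 - 2 * (2 : ℝ) ^ (-((ψ n - 1) / 2))) atTop (nhds 1) := by
    have h1 : Tendsto (fun n => (ψ n - 1) / 2) atTop atTop :=
      (tendsto_atTop_add_const_right _ (-1) hψ).atTop_div_const two_pos
    have h2 := (tendsto_rpow_atBot_of_base_gt_one 2 one_lt_two).comp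
      (tendsto_neg_atTop_atBot.comp h1)
    simpa using (h2.const_mul 2).const_sub 1
  refine tendsto_of_tendsto_of_tendsto_of_le_of_le' (hlim.mono_left inf_le_left)
    tendsto_const_nhds ?_ ?_
  all_goals
    rw [eventually_inf_principal]
    filter_upwards [eventually_ge_atTop 2, hψ.eventually_ge_atTop 3] with n hn hψn hne
  · have hlog : 0 ≤ Real.logb 2 n := Real.logb_nonneg one_lt_two (by exact_mod_cast (by omega))
    have hk3 : 3 ≤ k n := by
      have h3 : (3 : ℝ) ≤ k n := by linarith [hkn n hne]
      exact_mod_cast h3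
    have hq : 4 ≤ Fintype.card (MixedPattern (k n)) := by
      have h1 := two_pow_le_card_mixedPattern (k n)
      have h2 := Nat.pow_le_pow_right two_pos hk3
      omega
    linarith [one_sub_le_ratio hn hne (hk n) hq,
      two_mul_div_sqrt_card_le (by omega) (by omega) (hkn n hne)]
  · refine div_le_one_of_le₀ ?_ (Nat.cast_nonneg _)
    exact_mod_cast Set.ncard_le_ncard (Set.sep_subset _ _) (H0nk_finite hn (hk n))
end
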